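/- arXiv:2312.00430 — 2 statements merged into one kernel-verified Lean document; each statement's English description precedes it below -/
import Mathlib

section
/- Let $G$ be a finite elementary graph with clique number $\omega(G)$. Then for every list assignment $L$ with $|L(v)| \ge \omega(G)$ for all vertices $v$, the graph $G$ admits a proper $L$-coloring; that is, $G$ is $\omega(G)$-choosable. -/
/-- A graph is *elementary* if its edges can be 2-colored so that the two edges
of every induced path on three vertices receive distinct colors. -/
def SimpleGraph.IsElementary {V : Type*} (G : SimpleGraph V) : Prop :=
  ∃ col : Sym2 V → Bool,
    ∀ a b c : V, G.Adj a b → G.Adj b c → ¬ G.Adj a c → a ≠ c →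
      col s(a, b) ≠ col s(b, c)

/-- Hall's theorem for a family indexed by a finite set. -/
theorem Finset.exists_injOn_of_card_le_biUnion {ι α : Type*} [DecidableEq ι] [DecidableEq α]
    [Nonempty α] (J : Finset ι) (t : ι → Finset α)
    (h : ∀ W ⊆ J, W.card ≤ (W.biUnion t).card) :
    ∃ f : ι → α, Set.InjOn f J ∧ ∀ j ∈ J, f j ∈ t j := by
  classical
  obtain ⟨f, hf, hft⟩ := (Finset.all_card_le_biUnion_card_iff_exists_injective
    (fun j : J => t j)).1 (by
      intro W
      have := h (W.map (Function.Embedding.subtype _)) (by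
        intro x hx
        simp only [Finset.mem_map, Function.Embedding.subtype_apply] at hx
        obtain ⟨a, -, rfl⟩ := hx
        exact a.2)
      rw [Finset.card_map] at this
      refine this.trans (Finset.card_le_card ?_)
      intro x hx
      simp only [Finset.mem_biUnion, Finset.mem_map, Function.Embedding.subtype_apply] at hx ⊢
      obtain ⟨_, ⟨a, ha, rfl⟩, hx⟩ := hx
      exact ⟨a, ha, hx⟩)
  refine ⟨fun j => if hj : j ∈ J then f ⟨j, hj⟩ else Classical.arbitrary α, ?_, ?_⟩
  · intro a ha b hb hab
    have ha' : a ∈ J := ha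
    have hb' : b ∈ J := hb
    simp only [ha', hb', dif_pos] at hab
    simpa using hf hab
  · intro j hj
    simpa [hj] using hft ⟨j, hj⟩

section Galvin

variable {V U W : Type*} [DecidableEq V]

/-- Stable matchings: a set of edges of a bipartite multigraph, ranked by `φ` at the ends `r` and
in the opposite way at the ends `b`, has a kernel. -/
theorem exists_kernel (r : V → U) (b : V → W) (φ : V → ℕ)
    (hr : ∀ v w, r v = r w → φ v = φ w → v = w) (hb : ∀ v w, b v = b w → φ v = φ w → v = w)
    (S : Finset V) :
    ∃ K ⊆ S, (∀ v ∈ K, ∀ w ∈ K, v ≠ w → r v ≠ r w ∧ b v ≠ b w) ∧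
      ∀ v ∈ S, v ∉ K → ∃ w ∈ K, (r w = r v ∧ φ w < φ v) ∨ (b w = b v ∧ φ v < φ w) := by
  classical
  induction S using Finset.strongInduction with
  | H S ih =>
    set M := S.filter fun v => ∀ w ∈ S, r w = r v → φ v ≤ φ w with hM
    by_cases h : ∃ v ∈ M, ∃ v' ∈ M, b v = b v' ∧ φ v < φ v'
    · obtain ⟨v, hv, v', hv', hbv, hlt⟩ := h
      simp only [hM, Finset.mem_filter] at hv hv'
      obtain ⟨K, hKS, hK, hab⟩ := ih (S.erase v) (Finset.erase_ssubset hv.1)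
      refine ⟨K, hKS.trans (Finset.erase_subset _ _), hK, fun w hw hwK => ?_⟩
      by_cases hwv : w = v
      · subst hwv
        by_cases hv'K : v' ∈ K
        · exact ⟨v', hv'K, Or.inr ⟨hbv.symm, hlt⟩⟩
        · obtain ⟨x, hx, h1 | h1⟩ := hab v' (Finset.mem_erase.2 ⟨by rintro rfl; omega, hv'.1⟩) hv'K
          · have := hv'.2 x (Finset.mem_of_mem_erase (hKS hx)) h1.1
            omega
          · exact ⟨x, hx, Or.inr ⟨h1.1.trans hbv.symm, hlt.trans h1.2⟩⟩
      · exact hab w (Finset.mem_erase.2 ⟨hwv, hw⟩) hwK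
    · push Not at h
      refine ⟨M, Finset.filter_subset _ _, fun v hv w hw hne => ⟨fun e => hne ?_, fun e => hne ?_⟩,
        fun v hv hvM => ?_⟩
      · have h1 := (Finset.mem_filter.1 hv).2 w (Finset.mem_filter.1 hw).1 e.symm
        have h2 := (Finset.mem_filter.1 hw).2 v (Finset.mem_filter.1 hv).1 e
        exact hr _ _ e (le_antisymm h1 h2)
      · exact hb _ _ e (le_antisymm (h w hw v hv e.symm) (h v hv w hw e))
      · obtain ⟨w, hw, hmin⟩ := Finset.exists_min_image (S.filter fun w => r w = r v) φ
          ⟨v, by simp [hv]⟩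
        simp only [Finset.mem_filter] at hw hmin
        have hwM : w ∈ M := Finset.mem_filter.2
          ⟨hw.1, fun x hx hxw => hmin x ⟨hx, hxw.trans hw.2⟩⟩
        refine ⟨w, hwM, Or.inl ⟨hw.2, lt_of_le_of_ne (hmin v ⟨hv, rfl⟩) fun e => hvM ?_⟩⟩
        rwa [← hr _ _ hw.2 e]

/-- Galvin's argument, in terms of out-degrees. -/
theorem exists_listColoring_of_outdegree_lt (r : V → U) (b : V → W) (φ : V → ℕ)
    [DecidableEq U] [DecidableEq W]
    (hr : ∀ v w, r v = r w → φ v = φ w → v = w) (hb : ∀ v w, b v = b w → φ v = φ w → v = w)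
    (S : Finset V) (L : V → Finset ℕ)
    (hL : ∀ v ∈ S, (S.filter fun w => (r w = r v ∧ φ w < φ v) ∨ (b w = b v ∧ φ v < φ w)).card <
      (L v).card) :
    ∃ c : V → ℕ, (∀ v ∈ S, c v ∈ L v) ∧
      ∀ v ∈ S, ∀ w ∈ S, v ≠ w → (r v = r w ∨ b v = b w) → c v ≠ c w := by
  classical
  induction S using Finset.strongInduction generalizing L with
  | H S ih =>
    obtain rfl | ⟨v₀, hv₀⟩ := S.eq_empty_or_nonempty
    · exact ⟨fun _ => 0, by simp, by simp⟩
    obtain ⟨x, hx⟩ := Finset.card_pos.1 ((Nat.zero_le _).trans_lt (hL v₀ hv₀))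
    obtain ⟨K, hKS, hK, hab⟩ := exists_kernel r b φ hr hb (S.filter fun v => x ∈ L v)
    have hKne : K.Nonempty := by
      by_cases h : v₀ ∈ K
      · exact ⟨_, h⟩
      · obtain ⟨w, hw, -⟩ := hab v₀ (by simp [hv₀, hx]) h
        exact ⟨w, hw⟩
    have hKS' : K ⊆ S := hKS.trans (Finset.filter_subset _ _)
    obtain ⟨c, hc, hc'⟩ := ih (S \ K) (Finset.sdiff_ssubset hKS' hKne) (fun v => (L v).erase x) (by
      intro v hv
      rw [Finset.mem_sdiff] at hv
      by_cases hxv : x ∈ L v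
      · obtain ⟨w, hw, hw'⟩ := hab v (by simp [hv.1, hxv]) hv.2
        rw [Finset.card_erase_of_mem hxv]
        have h1 := hL v hv.1
        have h2 : ((S \ K).filter fun w =>
            (r w = r v ∧ φ w < φ v) ∨ (b w = b v ∧ φ v < φ w)).card <
            (S.filter fun w => (r w = r v ∧ φ w < φ v) ∨ (b w = b v ∧ φ v < φ w)).card := by
          refine Finset.card_lt_card (Finset.ssubset_iff_of_subset
            (Finset.filter_subset_filter _ Finset.sdiff_subset) |>.2 ⟨w, ?_, ?_⟩)
          · exact Finset.mem_filter.2 ⟨hKS' hw, hw'⟩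
          · simp [hw]
        omega
      · rw [Finset.erase_eq_of_notMem hxv]
        exact (Finset.card_le_card (Finset.filter_subset_filter _ Finset.sdiff_subset)).trans_lt
          (hL v hv.1))
    refine ⟨fun v => if v ∈ K then x else c v, fun v hv => ?_, fun v hv w hw hne hvw => ?_⟩
    · by_cases h : v ∈ K
      · simpa [h] using (Finset.mem_filter.1 (hKS h)).2
      · simpa [h] using Finset.mem_of_mem_erase (hc v (by simp [hv, h]))
    · have key : ∀ v ∈ S, v ∉ K → c v ≠ x := fun v hv h =>
        Finset.ne_of_mem_erase (hc v (by simp [hv, h]))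
      by_cases h : v ∈ K <;> by_cases h' : w ∈ K
      · have := hK v h w h' hne
        tauto
      · simpa [h, h'] using (key w hw h').symm
      · simpa [h, h'] using key v hv h
      · simpa [h, h'] using hc' v (by simp [hv, h]) w (by simp [hw, h']) hne hvw

end Galvin

section Koenig

/-- An `N`-regular bipartite multigraph (edge set `S`, ends `f` and `g`) is `N`-edge-colourable. -/
theorem exists_edgeColoring_of_regular {E X : Type*} [DecidableEq E] [Fintype X] [DecidableEq X]
    (f g : E → X) (N : ℕ) (S : Finset E)
    (hf : ∀ x, (S.filter fun e => f e = x).card = N)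
    (hg : ∀ x, (S.filter fun e => g e = x).card = N) :
    ∃ φ : E → ℕ, (∀ e ∈ S, φ e < N) ∧
      (∀ e ∈ S, ∀ e' ∈ S, f e = f e' → φ e = φ e' → e = e') ∧
      ∀ e ∈ S, ∀ e' ∈ S, g e = g e' → φ e = φ e' → e = e' := by
  classical
  induction N generalizing S with
  | zero =>
    have hS : ∀ e, e ∉ S := by
      intro e he
      have := Finset.card_eq_zero.1 (hf (f e))
      have h2 : e ∈ S.filter fun e' => f e' = f e := by simp [he]
      simp [this] at h2
    exact ⟨fun _ => 0, fun e he => (hS e he).elim, fun e he => (hS e he).elim,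
      fun e he => (hS e he).elim⟩
  | succ N ih =>
    obtain ⟨h, hinj, hh⟩ := (Finset.all_card_le_biUnion_card_iff_exists_injective
      (fun x => (S.filter fun e => f e = x).image g)).1 (by
        intro W
        set W' := W.biUnion fun x => (S.filter fun e => f e = x).image g with hW'
        have h1 : (S.filter fun e => f e ∈ W).card = W.card * (N + 1) := by
          rw [Finset.card_eq_sum_card_fiberwise (f := f) (t := W) (by intro e he; simp_all)]
          rw [Finset.sum_const_nat (m := N + 1)]
          intro x hx
          rw [← hf x]
          congr 1
          ext e
          simp only [Finset.mem_filter]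
          constructor
          · tauto
          · rintro ⟨h1, rfl⟩
            tauto
        have h2 : (S.filter fun e => g e ∈ W').card = W'.card * (N + 1) := by
          rw [Finset.card_eq_sum_card_fiberwise (f := g) (t := W') (by intro e he; simp_all)]
          rw [Finset.sum_const_nat (m := N + 1)]
          intro x hx
          rw [← hg x]
          congr 1
          ext e
          simp only [Finset.mem_filter]
          constructor
          · tauto
          · rintro ⟨h1, rfl⟩
            tauto
        have h3 : (S.filter fun e => f e ∈ W).card ≤ (S.filter fun e => g e ∈ W').card := by
          refine Finset.card_le_card fun e he => ?_
          rw [Finset.mem_filter] at he ⊢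
          refine ⟨he.1, Finset.mem_biUnion.2 ⟨f e, he.2, Finset.mem_image.2 ⟨e, by simp [he.1]⟩⟩⟩
        rw [h1, h2] at h3
        exact Nat.le_of_mul_le_mul_right h3 (Nat.succ_pos N))
    have hsurj : Function.Surjective h := Finite.surjective_of_injective hinj
    have : ∀ x, ∃ e ∈ S, f e = x ∧ g e = h x := by
      intro x
      obtain ⟨e, he, he'⟩ := Finset.mem_image.1 (hh x)
      rw [Finset.mem_filter] at he
      exact ⟨e, he.1, he.2, he'⟩
    choose m hmS hmf hmg using this
    set M := Finset.univ.image m with hM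
    have key : ∀ e ∈ M, m (f e) = e ∧ h (f e) = g e := by
      intro e he
      obtain ⟨x, -, rfl⟩ := Finset.mem_image.1 he
      simp [hmf, hmg]
    obtain ⟨φ, h1, h2, h3⟩ := ih (S \ M)
      (by
        intro x
        have : ((S \ M).filter fun e => f e = x) = (S.filter fun e => f e = x).erase (m x) := by
          ext e
          simp only [Finset.mem_filter, Finset.mem_sdiff, Finset.mem_erase]
          constructor
          · rintro ⟨⟨h1, h2⟩, h3⟩
            exact ⟨fun h => h2 (by rw [h]; simp [hM]), h1, h3⟩
          · rintro ⟨h1, h2, h3⟩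
            refine ⟨⟨h2, fun h => h1 ?_⟩, h3⟩
            rw [← h3, (key e h).1]
        rw [this, Finset.card_erase_of_mem (by simp [hmS, hmf]), hf]
        rfl)
      (by
        intro x
        obtain ⟨y, rfl⟩ := hsurj x
        have : ((S \ M).filter fun e => g e = h y) =
            (S.filter fun e => g e = h y).erase (m y) := by
          ext e
          simp only [Finset.mem_filter, Finset.mem_sdiff, Finset.mem_erase]
          constructor
          · rintro ⟨⟨h1, h2⟩, h3⟩
            exact ⟨fun h => h2 (by rw [h]; simp [hM]), h1, h3⟩
          · rintro ⟨h1, h2, h3⟩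
            refine ⟨⟨h2, fun h => h1 ?_⟩, h3⟩
            have := key e h
            rw [← this.1, hinj (this.2.trans h3)]
        rw [this, Finset.card_erase_of_mem (by simp [hmS, hmg]), hg]
        rfl)
    refine ⟨fun e => if e ∈ M then N else φ e, fun e he => ?_, fun e he e' he' hee hφ => ?_,
      fun e he e' he' hee hφ => ?_⟩
    · by_cases h : e ∈ M
      · simp [h]
      · simpa [h] using (h1 e (by simp [he, h])).trans (Nat.lt_succ_self N)
    · by_cases h : e ∈ M <;> by_cases h' : e' ∈ M
      · rw [← (key e h).1, ← (key e' h').1, hee]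
      · have := h1 e' (by simp [he', h'])
        simp only [h, h', if_true, if_false] at hφ
        omega
      · have := h1 e (by simp [he, h])
        simp only [h, h', if_true, if_false] at hφ
        omega
      · exact h2 e (by simp [he, h]) e' (by simp [he', h']) hee (by simpa [h, h'] using hφ)
    · by_cases h : e ∈ M <;> by_cases h' : e' ∈ M
      · rw [← (key e h).1, ← (key e' h').1]
        rw [← (key e h).2, ← (key e' h').2] at hee
        rw [hinj hee]
      · have := h1 e' (by simp [he', h'])
        simp only [h, h', if_true, if_false] at hφ
        omega
      · have := h1 e (by simp [he, h])
        simp only [h, h', if_true, if_false] at hφ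
        omega
      · exact h3 e (by simp [he, h]) e' (by simp [he', h']) hee (by simpa [h, h'] using hφ)

/-- König's edge-colouring theorem for bipartite multigraphs of maximum degree at most `N`. -/
theorem exists_edgeColoring {V U W : Type*} [Fintype V] [Fintype U] [Fintype W]
    [DecidableEq U] [DecidableEq W] (r : V → U) (b : V → W) (N : ℕ)
    (hr : ∀ u, (Finset.univ.filter fun v => r v = u).card ≤ N)
    (hb : ∀ w, (Finset.univ.filter fun v => b v = w).card ≤ N) :
    ∃ φ : V → ℕ, (∀ v, φ v < N) ∧ (∀ v w, r v = r w → φ v = φ w → v = w) ∧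
      ∀ v w, b v = b w → φ v = φ w → v = w := by
  classical
  let d : U ⊕ W → ℕ := Sum.elim (fun u => (Finset.univ.filter fun v => r v = u).card)
    (fun w => (Finset.univ.filter fun v => b v = w).card)
  have hd : ∀ x, d x ≤ N := by
    rintro (u | w)
    · exact hr u
    · exact hb w
  let f : V ⊕ V ⊕ (Σ x : U ⊕ W, Fin (N - d x)) → U ⊕ W :=
    Sum.elim (fun v => Sum.inl (r v)) (Sum.elim (fun v => Sum.inr (b v)) Sigma.fst)
  let g : V ⊕ V ⊕ (Σ x : U ⊕ W, Fin (N - d x)) → U ⊕ W :=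
    Sum.elim (fun v => Sum.inr (b v)) (Sum.elim (fun v => Sum.inl (r v)) Sigma.fst)
  have hcard : ∀ (p : V ⊕ V ⊕ (Σ x : U ⊕ W, Fin (N - d x)) → Prop) [DecidablePred p]
      (A B : Finset V) (x : U ⊕ W), (∀ v, p (Sum.inl v) ↔ v ∈ A) →
      (∀ v, p (Sum.inr (Sum.inl v)) ↔ v ∈ B) → (∀ e, p (Sum.inr (Sum.inr e)) ↔ e.1 = x) →
      (Finset.univ.filter p).card = A.card + (B.card + (N - d x)) := by
    intro p _ A B x hA hB hx
    have : Finset.univ.filter p =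
        A.disjSum (B.disjSum (({x} : Finset (U ⊕ W)).sigma fun _ => Finset.univ)) := by
      ext (v | v | e) <;> simp [hA, hB, hx]
    rw [this]
    simp
  obtain ⟨φ, h1, h2, h3⟩ := exists_edgeColoring_of_regular f g N Finset.univ
    (by
      intro x
      have := hd x
      rcases x with u | w
      · rw [hcard _ (Finset.univ.filter fun v => r v = u) ∅ (Sum.inl u) (by simp [f]) (by simp [f])
          (by simp [f])]
        simp only [d, Sum.elim_inl, Finset.card_empty] at this ⊢
        omega
      · rw [hcard _ ∅ (Finset.univ.filter fun v => b v = w) (Sum.inr w) (by simp [f]) (by simp [f])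
          (by simp [f])]
        simp only [d, Sum.elim_inr, Finset.card_empty] at this ⊢
        omega)
    (by
      intro x
      have := hd x
      rcases x with u | w
      · rw [hcard _ ∅ (Finset.univ.filter fun v => r v = u) (Sum.inl u) (by simp [g]) (by simp [g])
          (by simp [g])]
        simp only [d, Sum.elim_inl, Finset.card_empty] at this ⊢
        omega
      · rw [hcard _ (Finset.univ.filter fun v => b v = w) ∅ (Sum.inr w) (by simp [g]) (by simp [g])
          (by simp [g])]
        simp only [d, Sum.elim_inr, Finset.card_empty] at this ⊢
        omega)
  refine ⟨fun v => φ (Sum.inl v), fun v => h1 _ (Finset.mem_univ _), fun v w hvw hφ => ?_,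
    fun v w hvw hφ => ?_⟩
  · exact Sum.inl_injective (h2 _ (Finset.mem_univ _) _ (Finset.mem_univ _)
      (congrArg Sum.inl hvw) hφ)
  · exact Sum.inl_injective (h3 _ (Finset.mem_univ _) _ (Finset.mem_univ _)
      (congrArg Sum.inr hvw) hφ)

end Koenig

/-- Distinct representatives for single vertices and for pairs, the two members of a pair being
allowed to share their representative. -/
theorem exists_pair_representatives {V ι : Type*} [DecidableEq V] [DecidableEq ι]
    (ρ : Finset V) (I : Finset ι) (l : V → Finset ℕ) (Lx Ly : ι → Finset ℕ) (p q : ℕ)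
    (hx : ∀ i ∈ I, p ≤ (Lx i).card) (hy : ∀ i ∈ I, q ≤ (Ly i).card)
    (hp : I.card ≤ p) (hq : I.card ≤ q) (hpq : ρ.card + 2 * I.card ≤ p + q)
    (hT : ∀ T ⊆ ρ, T.Nonempty → T.card + I.card ≤ (T.biUnion l).card) :
    ∃ (c : V → ℕ) (cx cy : ι → ℕ), (∀ v ∈ ρ, c v ∈ l v) ∧ (∀ i ∈ I, cx i ∈ Lx i ∧ cy i ∈ Ly i) ∧
      Set.InjOn c ρ ∧ Set.InjOn cx I ∧ Set.InjOn cy I ∧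
      (∀ v ∈ ρ, ∀ i ∈ I, c v ≠ cx i ∧ c v ≠ cy i) ∧ ∀ i ∈ I, ∀ j ∈ I, i ≠ j → cx i ≠ cy j := by
  induction I using Finset.strongInduction generalizing p q l Lx Ly with
  | H I ih =>
    by_cases hcom : ∃ i ∈ I, ∃ x, x ∈ Lx i ∧ x ∈ Ly i
    · obtain ⟨i, hi, x, hxx, hxy⟩ := hcom
      have hI : (I.erase i).card + 1 = I.card := Finset.card_erase_add_one hi
      have her : ∀ s : Finset ℕ, s.card ≤ (s.erase x).card + 1 := fun s => by
        have := Finset.pred_card_le_card_erase (s := s) (a := x)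
        omega
      obtain ⟨c, cx, cy, h1, h2, h3, h4, h5, h6, h7⟩ := ih (I.erase i) (Finset.erase_ssubset hi)
        (fun v => (l v).erase x) (fun j => (Lx j).erase x) (fun j => (Ly j).erase x) (p - 1) (q - 1)
        (fun j hj => by
          have := hx j (Finset.mem_of_mem_erase hj)
          have := her (Lx j)
          omega)
        (fun j hj => by
          have := hy j (Finset.mem_of_mem_erase hj)
          have := her (Ly j)
          omega)
        (by omega) (by omega) (by omega)
        (by
          intro T hTρ hTn
          have := hT T hTρ hTn
          rw [← Finset.erase_biUnion]
          have := her (T.biUnion l)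
          omega)
      simp only [Finset.mem_erase] at h1 h2 h6 h7
      refine ⟨c, Function.update cx i x, Function.update cy i x, fun v hv => (h1 v hv).2, ?_, h3,
        ?_, ?_, ?_, ?_⟩
      · intro j hj
        by_cases hji : j = i
        · subst hji
          simp [hxx, hxy]
        · have := h2 j ⟨hji, hj⟩
          simp [hji, this]
      · intro j hj k hk hjk
        by_cases hji : j = i <;> by_cases hki : k = i
        · rw [hji, hki]
        · subst hji
          have := h2 k ⟨hki, hk⟩
          simp [hki] at hjk
          exact (this.1.1 hjk.symm).elim
        · subst hki
          have := h2 j ⟨hji, hj⟩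
          simp [hji] at hjk
          exact (this.1.1 hjk).elim
        · simp only [hji, hki, ne_eq, not_false_eq_true, Function.update_of_ne] at hjk
          exact h4 (Finset.mem_erase.2 ⟨hji, hj⟩) (Finset.mem_erase.2 ⟨hki, hk⟩) hjk
      · intro j hj k hk hjk
        by_cases hji : j = i <;> by_cases hki : k = i
        · rw [hji, hki]
        · subst hji
          have := h2 k ⟨hki, hk⟩
          simp [hki] at hjk
          exact (this.2.1 hjk.symm).elim
        · subst hki
          have := h2 j ⟨hji, hj⟩
          simp [hji] at hjk
          exact (this.2.1 hjk).elim
        · simp only [hji, hki, ne_eq, not_false_eq_true, Function.update_of_ne] at hjk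
          exact h5 (Finset.mem_erase.2 ⟨hji, hj⟩) (Finset.mem_erase.2 ⟨hki, hk⟩) hjk
      · intro v hv j hj
        by_cases hji : j = i
        · subst hji
          simpa using (h1 v hv).1
        · simpa [hji] using h6 v hv j ⟨hji, hj⟩
      · intro j hj k hk hjk
        by_cases hji : j = i <;> by_cases hki : k = i
        · exact (hjk (hji.trans hki.symm)).elim
        · subst hji
          simpa [hki] using (h2 k ⟨hki, hk⟩).2.1.symm
        · subst hki
          simpa [hji] using (h2 j ⟨hji, hj⟩).1.1
        · simpa [hji, hki] using h7 j ⟨hji, hj⟩ k ⟨hki, hk⟩ hjk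
    · push Not at hcom
      obtain ⟨f, hf, hft⟩ := Finset.exists_injOn_of_card_le_biUnion (ρ.disjSum (I.disjSum I))
        (Sum.elim l (Sum.elim Lx Ly)) (by
          intro W hW
          have hmem : ∀ w ∈ W, Sum.elim l (Sum.elim Lx Ly) w ⊆
              W.biUnion (Sum.elim l (Sum.elim Lx Ly)) :=
            fun w hw => Finset.subset_biUnion_of_mem _ hw
          have hWc := Finset.card_le_card hW
          rw [Finset.card_disjSum, Finset.card_disjSum] at hWc
          have hS : W.toLeft ⊆ ρ := fun v hv => by
            simpa using hW (Finset.mem_toLeft.1 hv)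
          have hX : W.toRight.toLeft ⊆ I := fun v hv => by
            simpa using hW (Finset.mem_toRight.1 (Finset.mem_toLeft.1 hv))
          have hY : W.toRight.toRight ⊆ I := fun v hv => by
            simpa using hW (Finset.mem_toRight.1 (Finset.mem_toRight.1 hv))
          have hsum : W.card =
              W.toLeft.card + (W.toRight.toLeft.card + W.toRight.toRight.card) := by
            rw [Finset.card_toLeft_add_card_toRight, Finset.card_toLeft_add_card_toRight]
          by_cases hpair : Disjoint W.toRight.toLeft W.toRight.toRight
          · have hXY : W.toRight.toLeft.card + W.toRight.toRight.card ≤ I.card := by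
              rw [← Finset.card_union_of_disjoint hpair]
              exact Finset.card_le_card (Finset.union_subset hX hY)
            by_cases hSn : W.toLeft.Nonempty
            · have h1 := hT _ hS hSn
              have h2 : W.toLeft.biUnion l ⊆ W.biUnion (Sum.elim l (Sum.elim Lx Ly)) :=
                Finset.biUnion_subset.2 fun v hv => hmem _ (Finset.mem_toLeft.1 hv)
              have := Finset.card_le_card h2
              omega
            · rw [Finset.not_nonempty_iff_eq_empty] at hSn
              obtain rfl | ⟨w, hw⟩ := W.eq_empty_or_nonempty
              · simp
              have h1 := Finset.card_le_card (hmem w hw)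
              have h2 := hW hw
              rw [hSn, Finset.card_empty] at hsum
              rcases w with v | i | i
              · have : v ∈ W.toLeft := Finset.mem_toLeft.2 hw
                simp [hSn] at this
              · have := hx i (by simpa using h2)
                simp only [Sum.elim_inl, Sum.elim_inr] at h1
                omega
              · have := hy i (by simpa using h2)
                simp only [Sum.elim_inr] at h1
                omega
          · obtain ⟨i, hi, hi'⟩ := Finset.not_disjoint_iff.1 hpair
            have h1 := hx i (hX hi)
            have h2 := hy i (hX hi)
            have h3 : Disjoint (Lx i) (Ly i) := Finset.disjoint_left.2 (hcom i (hX hi))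
            have h4 : Lx i ∪ Ly i ⊆ W.biUnion (Sum.elim l (Sum.elim Lx Ly)) :=
              Finset.union_subset
                (hmem _ (Finset.mem_toRight.1 (Finset.mem_toLeft.1 hi)))
                (hmem _ (Finset.mem_toRight.1 (Finset.mem_toRight.1 hi')))
            have h5 := Finset.card_le_card h4
            rw [Finset.card_union_of_disjoint h3] at h5
            omega)
      have hft1 : ∀ v ∈ ρ, f (Sum.inl v) ∈ l v := fun v hv => hft _ (by simpa using hv)
      have hft2 : ∀ i ∈ I, f (Sum.inr (Sum.inl i)) ∈ Lx i := fun v hv => hft _ (by simpa using hv)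
      have hft3 : ∀ i ∈ I, f (Sum.inr (Sum.inr i)) ∈ Ly i := fun v hv => hft _ (by simpa using hv)
      have hinj : ∀ a ∈ ρ.disjSum (I.disjSum I), ∀ b ∈ ρ.disjSum (I.disjSum I), a ≠ b → f a ≠ f b :=
        fun a ha b hb hab h => hab (hf ha hb h)
      refine ⟨fun v => f (Sum.inl v), fun i => f (Sum.inr (Sum.inl i)),
        fun i => f (Sum.inr (Sum.inr i)), hft1, fun i hi => ⟨hft2 i hi, hft3 i hi⟩,
        ?_, ?_, ?_, ?_, ?_⟩
      · intro a ha b hb hab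
        simpa using hf (by simpa using ha) (by simpa using hb) hab
      · intro a ha b hb hab
        simpa using hf (by simpa using ha) (by simpa using hb) hab
      · intro a ha b hb hab
        simpa using hf (by simpa using ha) (by simpa using hb) hab
      · intro v hv i hi
        exact ⟨hinj _ (by simpa using hv) _ (by simpa using hi) (by simp),
          hinj _ (by simpa using hv) _ (by simpa using hi) (by simp)⟩
      · intro i hi j hj hij
        exact hinj _ (by simpa using hi) _ (by simpa using hj) (by simp)

section Phantom

variable {V ι : Type*} [DecidableEq V] [DecidableEq ι]

/-- If no element of `A` lies in all members of a family, then the part of `A` in one member is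
disjoint from the part of `A` common to the others. -/
theorem card_inter_add_card_filter_erase_le (A : Finset V) (T : ι → Finset V) (K : Finset ι) {j : ι}
    (hK : (A.filter fun v => ∀ i ∈ K, v ∈ T i).card = 0) :
    (A.filter fun v => ∀ i ∈ K.erase j, v ∈ T i).card + (A ∩ T j).card ≤ A.card := by
  rw [← Finset.card_union_of_disjoint]
  · exact Finset.card_le_card (Finset.union_subset (Finset.filter_subset _ _)
      Finset.inter_subset_left)
  · rw [Finset.disjoint_left]
    intro v hv hv'
    rw [Finset.mem_filter] at hv
    rw [Finset.card_eq_zero, Finset.filter_eq_empty_iff] at hK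
    refine hK hv.1 fun i hi => ?_
    by_cases h : i = j
    · exact h ▸ (Finset.mem_inter.1 hv').2
    · exact hv.2 i (Finset.mem_erase.2 ⟨h, hi⟩)

theorem card_filter_pos_of_lt (A B : Finset V) (T : ι → Finset V)
    (hB : ∀ K : Finset ι, 0 < (B.filter fun v => ∀ i ∈ K, v ∈ T i).card → ∀ k ∈ K,
      B.card + 1 ≤ (B.filter fun v => ∀ i ∈ K, v ∈ T i).card + (A ∩ T k).card)
    (hBT : ∀ i, 0 < (B ∩ T i).card) (K : Finset ι) (hK : K.Nonempty)
    (hlt : ∀ i ∈ K, ∀ j ∈ K, i ≠ j → (A ∩ T j).card < (B ∩ T i).card) :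
    0 < (B.filter fun v => ∀ i ∈ K, v ∈ T i).card := by
  induction K using Finset.strongInduction with
  | H K ih =>
    obtain ⟨l, hl⟩ := hK
    by_contra h0
    have h1 := card_inter_add_card_filter_erase_le B T K (j := l) (by omega)
    by_cases hne : (K.erase l).Nonempty
    · obtain ⟨i, hi⟩ := hne
      have h2 := ih (K.erase l) (Finset.erase_ssubset hl) ⟨i, hi⟩ fun a ha b hb =>
        hlt a (Finset.mem_of_mem_erase ha) b (Finset.mem_of_mem_erase hb)
      have h3 := hB _ h2 i hi
      have h4 := hlt l hl i (Finset.mem_of_mem_erase hi) (Finset.ne_of_mem_erase hi).symm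
      omega
    · have h2 := hBT l
      rw [Finset.not_nonempty_iff_eq_empty] at hne
      rw [hne] at h1
      simp only [Finset.notMem_empty, IsEmpty.forall_iff, implies_true, Finset.filter_true] at h1
      omega

/-- A Helly-type property: the members of any finite subfamily have a common element. -/
theorem exists_mem_forall_mem (A B : Finset V) (T : ι → Finset V)
    (hA : ∀ K : Finset ι, 0 < (A.filter fun v => ∀ i ∈ K, v ∈ T i).card → ∀ k ∈ K,
      A.card + 1 ≤ (A.filter fun v => ∀ i ∈ K, v ∈ T i).card + (B ∩ T k).card)
    (hB : ∀ K : Finset ι, 0 < (B.filter fun v => ∀ i ∈ K, v ∈ T i).card → ∀ k ∈ K,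
      B.card + 1 ≤ (B.filter fun v => ∀ i ∈ K, v ∈ T i).card + (A ∩ T k).card)
    (hT : ∀ i, 0 < (A ∩ T i).card ∨ 0 < (B ∩ T i).card) (K : Finset ι) (hK : K.Nonempty) :
    0 < (A.filter fun v => ∀ i ∈ K, v ∈ T i).card ∨
      0 < (B.filter fun v => ∀ i ∈ K, v ∈ T i).card := by
  have hsing : ∀ (A : Finset V) (i : ι), (A.filter fun v => ∀ j ∈ ({i} : Finset ι), v ∈ T j) =
      A ∩ T i := fun A i => by
    ext v
    simp
  have hboth : ∀ i, 0 < (A ∩ T i).card ∧ 0 < (B ∩ T i).card := by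
    intro i
    have h1 := hA {i}
    have h2 := hB {i}
    rw [hsing] at h1 h2
    have h3 : (A ∩ T i).card ≤ A.card := Finset.card_le_card Finset.inter_subset_left
    have h4 : (B ∩ T i).card ≤ B.card := Finset.card_le_card Finset.inter_subset_left
    rcases hT i with h | h
    · have := h1 h i (by simp)
      omega
    · have := h2 h i (by simp)
      omega
  induction K using Finset.strongInduction with
  | H K ih =>
    by_contra! h0
    have hs : ∀ j ∈ K, 0 < (A.filter fun v => ∀ i ∈ K.erase j, v ∈ T i).card ∨
        0 < (B.filter fun v => ∀ i ∈ K.erase j, v ∈ T i).card := by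
      intro j hj
      by_cases hne : (K.erase j).Nonempty
      · exact ih _ (Finset.erase_ssubset hj) hne
      · rw [Finset.not_nonempty_iff_eq_empty] at hne
        have := (hboth j).1
        have : (A ∩ T j).card ≤ A.card := Finset.card_le_card Finset.inter_subset_left
        left
        rw [hne]
        simp
        rw [← Finset.card_pos]
        omega
    have hP : ∀ j ∈ K, 0 < (A.filter fun v => ∀ i ∈ K.erase j, v ∈ T i).card →
        ∀ i ∈ K, i ≠ j → (A ∩ T j).card < (B ∩ T i).card := by
      intro j hj h i hi hij
      have h1 := card_inter_add_card_filter_erase_le A T K (j := j) (by omega)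
      have h2 := hA _ h i (Finset.mem_erase.2 ⟨hij, hi⟩)
      omega
    have hQ : ∀ j ∈ K, 0 < (B.filter fun v => ∀ i ∈ K.erase j, v ∈ T i).card →
        ∀ i ∈ K, i ≠ j → (B ∩ T j).card < (A ∩ T i).card := by
      intro j hj h i hi hij
      have h1 := card_inter_add_card_filter_erase_le B T K (j := j) (by omega)
      have h2 := hB _ h i (Finset.mem_erase.2 ⟨hij, hi⟩)
      omega
    by_cases hall : ∀ j ∈ K, 0 < (A.filter fun v => ∀ i ∈ K.erase j, v ∈ T i).card
    · have := card_filter_pos_of_lt A B T hB (fun i => (hboth i).2) K hK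
        fun i hi j hj hij => hP j hj (hall j hj) i hi hij
      omega
    · push Not at hall
      obtain ⟨j, hj, hj0⟩ := hall
      have hjB := (hs j hj).resolve_left (by omega)
      have hall' : ∀ l ∈ K, 0 < (B.filter fun v => ∀ i ∈ K.erase l, v ∈ T i).card := by
        intro l hl
        by_cases hlj : l = j
        · rwa [hlj]
        · refine (hs l hl).resolve_left fun h => ?_
          have h1 := hP l hl h j hj (Ne.symm hlj)
          have h2 := hQ j hj hjB l hl hlj
          omega
      have := card_filter_pos_of_lt B A T hA (fun i => (hboth i).1) K hK
        fun i hi j hj hij => hQ j hj (hall' j hj) i hi hij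
      omega

/-- Intersecting further members of the family loses at least as many colours as vertices. -/
theorem card_filter_add_card_inter_le (A : Finset V) (L : V → Finset ℕ) (T : ι → Finset V)
    (Z : ι → Finset ℕ) (hZ : ∀ i, ∀ v ∈ A ∩ T i, L v ⊆ Z i)
    (hroom : ∀ i, ∀ S ⊆ A \ T i, S.card ≤ (S.biUnion L \ Z i).card) (k : ι) (J : Finset ι) :
    ((Z k).filter fun x => ∀ i ∈ J, x ∈ Z i).card + (A ∩ T k).card ≤
      (Z k).card + ((A ∩ T k).filter fun v => ∀ i ∈ J, v ∈ T i).card := by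
  induction J using Finset.induction_on with
  | empty => simp
  | insert j J hj ih =>
    set S := ((A ∩ T k).filter fun v => ∀ i ∈ J, v ∈ T i).filter fun v => v ∉ T j with hS
    have hSA : S ⊆ A \ T j := by
      intro v hv
      simp only [hS, Finset.mem_filter, Finset.mem_inter] at hv
      exact Finset.mem_sdiff.2 ⟨hv.1.1.1, hv.2⟩
    have h1 := hroom j S hSA
    have h2 : S.biUnion L \ Z j ⊆
        ((Z k).filter fun x => ∀ i ∈ J, x ∈ Z i).filter fun x => x ∉ Z j := by
      intro x hx
      obtain ⟨hx, hxj⟩ := Finset.mem_sdiff.1 hx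
      obtain ⟨v, hv, hxv⟩ := Finset.mem_biUnion.1 hx
      simp only [hS, Finset.mem_filter, Finset.mem_inter] at hv
      simp only [Finset.mem_filter]
      exact ⟨⟨hZ k v (Finset.mem_inter.2 hv.1.1) hxv, fun i hi =>
        hZ i v (Finset.mem_inter.2 ⟨hv.1.1.1, hv.1.2 i hi⟩) hxv⟩, hxj⟩
    have h3 := Finset.card_le_card h2
    have h4 := Finset.card_filter_add_card_filter_not (s := (Z k).filter fun x => ∀ i ∈ J, x ∈ Z i)
      (fun x => x ∈ Z j)
    have h5 : (((A ∩ T k).filter fun v => ∀ i ∈ J, v ∈ T i).filter fun v => v ∈ T j).card + S.card =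
        ((A ∩ T k).filter fun v => ∀ i ∈ J, v ∈ T i).card := by
      rw [hS]
      convert Finset.card_filter_add_card_filter_not _
    have h6 : ((Z k).filter fun x => ∀ i ∈ insert j J, x ∈ Z i) =
        ((Z k).filter fun x => ∀ i ∈ J, x ∈ Z i).filter fun x => x ∈ Z j := by
      ext x
      simp only [Finset.mem_filter, Finset.mem_insert, forall_eq_or_imp]
      tauto
    have h7 : ((A ∩ T k).filter fun v => ∀ i ∈ insert j J, v ∈ T i) =
        ((A ∩ T k).filter fun v => ∀ i ∈ J, v ∈ T i).filter fun v => v ∈ T j := by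
      ext x
      simp only [Finset.mem_filter, Finset.mem_insert, forall_eq_or_imp]
      tauto
    rw [h6, h7]
    omega

theorem card_add_one_le_of_room (A B : Finset V) (L : V → Finset ℕ) (T : ι → Finset V)
    (Z : ι → Finset ℕ) (m : ℕ) (hL : ∀ v ∈ A, A.card + B.card + m ≤ (L v).card)
    (hZ : ∀ i, ∀ v ∈ A ∩ T i, L v ⊆ Z i)
    (hroom : ∀ i, ∀ S ⊆ A \ T i, S.card ≤ (S.biUnion L \ Z i).card)
    (hcard : ∀ i, (Z i).card + 1 ≤ B.card + (A ∩ T i).card + (B ∩ T i).card + m)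
    (K : Finset ι) (hK : 0 < (A.filter fun v => ∀ i ∈ K, v ∈ T i).card) (k : ι) (hk : k ∈ K) :
    A.card + 1 ≤ (A.filter fun v => ∀ i ∈ K, v ∈ T i).card + (B ∩ T k).card := by
  have h1 := card_filter_add_card_inter_le A L T Z hZ hroom k K
  obtain ⟨v, hv⟩ := Finset.card_pos.1 hK
  rw [Finset.mem_filter] at hv
  have h2 : L v ⊆ (Z k).filter fun x => ∀ i ∈ K, x ∈ Z i := by
    intro x hx
    exact Finset.mem_filter.2 ⟨hZ k v (Finset.mem_inter.2 ⟨hv.1, hv.2 k hk⟩) hx, fun i hi =>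
      hZ i v (Finset.mem_inter.2 ⟨hv.1, hv.2 i hi⟩) hx⟩
  have h3 := Finset.card_le_card h2
  have h4 := hL v hv.1
  have h5 := hcard k
  have h6 : ((A ∩ T k).filter fun v => ∀ i ∈ K, v ∈ T i) = A.filter fun v => ∀ i ∈ K, v ∈ T i := by
    ext x
    simp only [Finset.mem_filter, Finset.mem_inter]
    constructor
    · tauto
    · rintro ⟨h1, h2⟩
      exact ⟨⟨h1, h2 k hk⟩, h2⟩
  rw [h6] at h1
  omega

end Phantom

/-- Remove the colours of `D` from the lists on `A`, and those of `E` from all other lists. -/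
def sideLists {V : Type*} [DecidableEq V] (A : Finset V) (L : V → Finset ℕ) (D E : Finset ℕ)
    (v : V) : Finset ℕ :=
  if v ∈ A then L v \ D else L v \ E

theorem card_le_card_biUnion_sdiff {V : Type*} [DecidableEq V] (L L' : V → Finset ℕ)
    (S T : Finset V) (D : Finset ℕ) (hS : Disjoint S T) (hL : ∀ v ∈ S, L' v = L v \ D)
    (hmin : (T.biUnion L').card + (T ∪ S).card ≤ ((T ∪ S).biUnion L').card + T.card) :
    S.card ≤ (S.biUnion L \ (T.biUnion L' ∪ D)).card := by
  rw [Finset.card_union_of_disjoint hS.symm] at hmin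
  have h1 : (T ∪ S).biUnion L' ⊆ T.biUnion L' ∪ (S.biUnion L \ (T.biUnion L' ∪ D)) := by
    intro x hx
    by_cases hxT : x ∈ T.biUnion L'
    · exact Finset.mem_union_left _ hxT
    · obtain ⟨v, hv, hxv⟩ := Finset.mem_biUnion.1 hx
      rcases Finset.mem_union.1 hv with hv | hv
      · exact (hxT (Finset.mem_biUnion.2 ⟨v, hv, hxv⟩)).elim
      · rw [hL v hv, Finset.mem_sdiff] at hxv
        refine Finset.mem_union_right _ (Finset.mem_sdiff.2
          ⟨Finset.mem_biUnion.2 ⟨v, hv, hxv.1⟩, ?_⟩)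
        rw [Finset.mem_union]
        exact fun h => h.elim hxT hxv.2
  have h2 := (Finset.card_le_card h1).trans (Finset.card_union_le _ _)
  omega

/-- There is a list of the common size which, on one of the two sides, is swallowed by some
violation of Hall's condition with excess `m`, whatever small sets of colours are forbidden. -/
theorem exists_phantom_list {V : Type*} [DecidableEq V] (A B : Finset V) (hAB : Disjoint A B)
    (L : V → Finset ℕ) (m : ℕ) (hL : ∀ v ∈ A ∪ B, A.card + B.card + m ≤ (L v).card) :
    ∃ M : Finset ℕ, A.card + B.card + m ≤ M.card ∧
      ((∀ D E : Finset ℕ, D.card ≤ B.card → E.card ≤ A.card →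
        (∃ T ⊆ A ∪ B, T.Nonempty ∧ (T.biUnion (sideLists A L D E)).card < T.card + m) →
        ∃ T ⊆ A ∪ B, T.Nonempty ∧ (T.biUnion (sideLists A L D E)).card < T.card + m ∧
          M \ D ⊆ T.biUnion (sideLists A L D E)) ∨
      (∀ D E : Finset ℕ, D.card ≤ B.card → E.card ≤ A.card →
        (∃ T ⊆ A ∪ B, T.Nonempty ∧ (T.biUnion (sideLists A L D E)).card < T.card + m) →
        ∃ T ⊆ A ∪ B, T.Nonempty ∧ (T.biUnion (sideLists A L D E)).card < T.card + m ∧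
          M \ E ⊆ T.biUnion (sideLists A L D E))) := by
  classical
  let ι := {d : Finset ℕ × Finset ℕ // d.1.card ≤ B.card ∧ d.2.card ≤ A.card ∧
    ∃ T ⊆ A ∪ B, T.Nonempty ∧ (T.biUnion (sideLists A L d.1 d.2)).card < T.card + m}
  have hex : ∀ i : ι, ∃ T ⊆ A ∪ B, T.Nonempty ∧
      (T.biUnion (sideLists A L i.1.1 i.1.2)).card < T.card + m ∧
      ∀ T' ⊆ A ∪ B, T'.Nonempty → (T.biUnion (sideLists A L i.1.1 i.1.2)).card + T'.card ≤
        (T'.biUnion (sideLists A L i.1.1 i.1.2)).card + T.card := by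
    rintro ⟨⟨D, E⟩, hD, hE, T₀, hT₀, hne₀, hlt₀⟩
    obtain ⟨T, hT, hmin⟩ := Finset.exists_min_image
      ((A ∪ B).powerset.filter fun T => T.Nonempty)
      (fun T => ((T.biUnion (sideLists A L D E)).card : ℤ) - T.card)
      ⟨T₀, Finset.mem_filter.2 ⟨Finset.mem_powerset.2 hT₀, hne₀⟩⟩
    simp only [Finset.mem_filter, Finset.mem_powerset, and_imp] at hT hmin
    refine ⟨T, hT.1, hT.2, ?_, fun T' h1 h2 => ?_⟩
    · have := hmin T₀ hT₀ hne₀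
      dsimp only at hlt₀ ⊢
      omega
    · have := hmin T' h1 h2
      dsimp only at hlt₀ ⊢
      omega
  choose T hTAB hTne hTlt hTmin using hex
  have hnotA : ∀ v ∈ B, v ∉ A := fun v hv hv' => Finset.disjoint_left.1 hAB hv' hv
  have hlistA : ∀ (i : ι), ∀ v ∈ A, sideLists A L i.1.1 i.1.2 v = L v \ i.1.1 :=
    fun i v hv => by simp [sideLists, hv]
  have hlistB : ∀ (i : ι), ∀ v ∈ B, sideLists A L i.1.1 i.1.2 v = L v \ i.1.2 :=
    fun i v hv => by simp [sideLists, hnotA v hv]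
  have hcardT : ∀ i, (A ∩ T i).card + (B ∩ T i).card = (T i).card := by
    intro i
    rw [← Finset.card_union_of_disjoint, ← Finset.union_inter_distrib_right,
      Finset.inter_eq_right.2 (hTAB i)]
    exact hAB.mono Finset.inter_subset_left Finset.inter_subset_left
  have hA := card_add_one_le_of_room A B L T
    (fun i => (T i).biUnion (sideLists A L i.1.1 i.1.2) ∪ i.1.1) m
    (fun v hv => hL v (Finset.mem_union_left _ hv))
    (fun i v hv x hx => by
      obtain ⟨hvA, hvT⟩ := Finset.mem_inter.1 hv
      by_cases hxD : x ∈ i.1.1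
      · exact Finset.mem_union_right _ hxD
      · refine Finset.mem_union_left _ (Finset.mem_biUnion.2 ⟨v, hvT, ?_⟩)
        rw [hlistA i v hvA]
        exact Finset.mem_sdiff.2 ⟨hx, hxD⟩)
    (fun i S hS => card_le_card_biUnion_sdiff L _ S (T i) i.1.1
      (Finset.disjoint_left.2 fun v hv => (Finset.mem_sdiff.1 (hS hv)).2)
      (fun v hv => hlistA i v (Finset.mem_sdiff.1 (hS hv)).1)
      (hTmin i _ (Finset.union_subset (hTAB i)
        ((hS.trans Finset.sdiff_subset).trans Finset.subset_union_left))
        ((hTne i).mono Finset.subset_union_left)))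
    (fun i => by
      have h1 := hTlt i
      have h2 := hcardT i
      have h3 := i.2.1
      have h4 := Finset.card_union_le ((T i).biUnion (sideLists A L i.1.1 i.1.2)) i.1.1
      omega)
  have hB := card_add_one_le_of_room B A L T
    (fun i => (T i).biUnion (sideLists A L i.1.1 i.1.2) ∪ i.1.2) m
    (fun v hv => by
      have := hL v (Finset.mem_union_right _ hv)
      omega)
    (fun i v hv x hx => by
      obtain ⟨hvA, hvT⟩ := Finset.mem_inter.1 hv
      by_cases hxD : x ∈ i.1.2
      · exact Finset.mem_union_right _ hxD
      · refine Finset.mem_union_left _ (Finset.mem_biUnion.2 ⟨v, hvT, ?_⟩)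
        rw [hlistB i v hvA]
        exact Finset.mem_sdiff.2 ⟨hx, hxD⟩)
    (fun i S hS => card_le_card_biUnion_sdiff L _ S (T i) i.1.2
      (Finset.disjoint_left.2 fun v hv => (Finset.mem_sdiff.1 (hS hv)).2)
      (fun v hv => hlistB i v (Finset.mem_sdiff.1 (hS hv)).1)
      (hTmin i _ (Finset.union_subset (hTAB i)
        ((hS.trans Finset.sdiff_subset).trans Finset.subset_union_right))
        ((hTne i).mono Finset.subset_union_left)))
    (fun i => by
      have h1 := hTlt i
      have h2 := hcardT i
      have h3 := i.2.2.1
      have h4 := Finset.card_union_le ((T i).biUnion (sideLists A L i.1.1 i.1.2)) i.1.2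
      omega)
  have hcommon : Nonempty ι → ∃ s ∈ A ∪ B, ∀ i, s ∈ T i := by
    rintro ⟨i₀⟩
    by_contra! hno
    have : Nonempty ι := ⟨i₀⟩
    choose! j hj using hno
    have := exists_mem_forall_mem A B T hA hB
      (fun i => by
        have h1 := Finset.card_pos.2 (hTne i)
        have h2 := hcardT i
        omega)
      (insert i₀ ((A ∪ B).image j)) (Finset.insert_nonempty _ _)
    rw [Finset.card_pos, Finset.card_pos] at this
    rcases this with ⟨v, hv⟩ | ⟨v, hv⟩ <;> rw [Finset.mem_filter] at hv
    · have hv' : v ∈ A ∪ B := Finset.mem_union_left _ hv.1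
      exact hj v hv' (hv.2 _ (Finset.mem_insert_of_mem (Finset.mem_image_of_mem _ hv')))
    · have hv' : v ∈ A ∪ B := Finset.mem_union_right _ hv.1
      exact hj v hv' (hv.2 _ (Finset.mem_insert_of_mem (Finset.mem_image_of_mem _ hv')))
  by_cases hι : Nonempty ι
  · obtain ⟨s, hs, hsT⟩ := hcommon hι
    refine ⟨L s, hL s hs, ?_⟩
    rcases Finset.mem_union.1 hs with hsA | hsB
    · left
      intro D E hD hE hdef
      let i : ι := ⟨(D, E), hD, hE, hdef⟩
      refine ⟨T i, hTAB i, hTne i, hTlt i, ?_⟩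
      rw [← hlistA i s hsA]
      exact Finset.subset_biUnion_of_mem _ (hsT i)
    · right
      intro D E hD hE hdef
      let i : ι := ⟨(D, E), hD, hE, hdef⟩
      refine ⟨T i, hTAB i, hTne i, hTlt i, ?_⟩
      rw [← hlistB i s hsB]
      exact Finset.subset_biUnion_of_mem _ (hsT i)
  · refine ⟨Finset.range (A.card + B.card + m), by simp, Or.inl ?_⟩
    intro D E hD hE hdef
    exact (hι ⟨⟨(D, E), hD, hE, hdef⟩⟩).elim

namespace SimpleGraph

variable {V : Type*} {R B : SimpleGraph V}

/-- Two graphs on the same vertices such that the ends of every two-edge path of either of them are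
adjacent in at least one of them. -/
structure IsPathPair (R B : SimpleGraph V) : Prop where
  left : ∀ a b c, R.Adj a b → R.Adj b c → a ≠ c → (R ⊔ B).Adj a c
  right : ∀ a b c, B.Adj a b → B.Adj b c → a ≠ c → (R ⊔ B).Adj a c

theorem IsPathPair.symm (h : IsPathPair R B) : IsPathPair B R :=
  ⟨fun a b c h1 h2 h3 => sup_comm R B ▸ h.right a b c h1 h2 h3,
    fun a b c h1 h2 h3 => sup_comm R B ▸ h.left a b c h1 h2 h3⟩

theorem Reachable.exists_dist_eq {u v : V} (h : R.Reachable u v) {a b : ℕ}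
    (hd : R.dist u v = a + b) :
    ∃ w, R.Reachable u w ∧ R.Reachable w v ∧ R.dist u w = a ∧ R.dist w v = b := by
  obtain ⟨p, hp⟩ := h.exists_walk_length_eq_dist
  have h1 := dist_le (p.take a)
  have h2 := dist_le (p.drop a)
  have h3 := (p.take a).reachable.dist_triangle_left v
  rw [Walk.take_length] at h1
  rw [Walk.drop_length] at h2
  exact ⟨p.getVert a, (p.take a).reachable, (p.drop a).reachable, by omega, by omega⟩

theorem IsPathPair.adj_of_even_dist (h : IsPathPair R B) {u v : V} (huv : R.Reachable u v)
    (hne : u ≠ v) (heven : Even (R.dist u v)) : B.Adj u v := by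
  obtain ⟨k, hk⟩ := heven
  induction k generalizing v with
  | zero => exact (hne (huv.dist_eq_zero_iff.1 hk)).elim
  | succ k ih =>
    have hnR : ¬ R.Adj u v := fun hadj => by
      rw [dist_eq_one_iff_adj.2 hadj] at hk
      omega
    obtain rfl | hk0 := k.eq_zero_or_pos
    · obtain ⟨w, -, -, h1, h2⟩ := huv.exists_dist_eq (a := 1) (b := 1) hk
      rw [dist_eq_one_iff_adj] at h1 h2
      exact (h.left _ _ _ h1 h2 hne).resolve_left hnR
    · obtain ⟨w, hw1, hw2, h1, h2⟩ := huv.exists_dist_eq (a := k + k) (b := 1 + 1) (by omega)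
      obtain ⟨x, -, -, h3, h4⟩ := hw2.exists_dist_eq h2
      rw [dist_eq_one_iff_adj] at h3 h4
      have hwv : w ≠ v := by
        rintro rfl
        simp at h2
      have huw : u ≠ w := by
        rintro rfl
        simp at h1
        omega
      have hB1 := ih hw1 huw h1
      have hB2 : B.Adj w v := (h.left _ _ _ h3 h4 hwv).resolve_left fun hadj => by
        rw [dist_eq_one_iff_adj.2 hadj] at h2
        omega
      exact (h.right _ _ _ hB1 hB2 hne).resolve_left hnR

theorem IsPathPair.false_of_adj_of_not_adj (h : IsPathPair R B) {a d v w : V}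
    (hRad : R.Reachable a d) (hRav : R.Reachable a v) (hvw : R.Adj v w)
    (had : a ≠ d) (had' : ¬ (R ⊔ B).Adj a d) (hva : v ≠ a) (hva' : ¬ (R ⊔ B).Adj v a)
    (hvd : v ≠ d) (hvd' : ¬ (R ⊔ B).Adj v d) (hwd : w ≠ d)
    (hwa : (R ⊔ B).Adj w a) : False := by
  simp only [sup_adj, not_or] at *
  have hBwa : B.Adj w a := hwa.resolve_left fun hadj =>
    absurd (h.left v w a hvw hadj hva) (by simp [hva'])
  have hwd' : ¬ R.Adj w d ∧ ¬ B.Adj w d :=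
    ⟨fun hadj => absurd (h.left v w d hvw hadj hvd) (by simp [hvd']),
      fun hadj => absurd (h.right a w d hBwa.symm hadj had) (by simp [had'])⟩
  have hRwd : R.Reachable w d := (hvw.reachable.symm.trans hRav.symm).trans hRad
  have hRvd : R.Reachable v d := hRav.symm.trans hRad
  have hkodd : ¬ Even (R.dist w d) := fun he => hwd'.2 (h.adj_of_even_dist hRwd hwd he)
  have hvodd : ¬ Even (R.dist v d) := fun he => hvd'.2 (h.adj_of_even_dist hRvd hvd he)
  rw [Nat.not_even_iff_odd] at hkodd hvodd
  obtain ⟨k, hk⟩ := hkodd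
  have hk0 : k ≠ 0 := by
    rintro rfl
    exact hwd'.1 (dist_eq_one_iff_adj.1 hk)
  obtain ⟨w₁, -, hw₁d, hww₁, hd₁⟩ := hRwd.exists_dist_eq (a := 1) (b := 2 * k) (by omega)
  obtain ⟨w₂, -, hw₂d, hw₁w₂, hd₂⟩ := hw₁d.exists_dist_eq (a := 1) (b := 2 * k - 1) (by omega)
  rw [dist_eq_one_iff_adj] at hww₁ hw₁w₂
  have hw₁ne : w₁ ≠ d := by
    rintro rfl
    simp at hd₁
    omega
  have hBw₁d : B.Adj w₁ d := h.adj_of_even_dist hw₁d hw₁ne (by rw [hd₁]; exact even_two_mul k)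
  have hww₂ne : w ≠ w₂ := by
    rintro rfl
    omega
  have htri : ∀ x y, R.Adj x y → R.dist x d ≤ 1 + R.dist y d := fun x y hxy => by
    have := hxy.reachable.dist_triangle_left d
    rwa [dist_eq_one_iff_adj.2 hxy] at this
  have hBww₂ : B.Adj w w₂ := (h.left _ _ _ hww₁ hw₁w₂ hww₂ne).resolve_left fun hadj => by
    have := htri _ _ hadj
    omega
  have hvw₁ne : v ≠ w₁ := by
    rintro rfl
    exact hvd'.2 hBw₁d
  have hvw₁ : R.Adj v w₁ := (h.left _ _ _ hvw hww₁ hvw₁ne).resolve_right fun hadj =>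
    absurd (h.right v w₁ d hadj hBw₁d hvd) (by simp [hvd'])
  have haw₁ : ¬ R.Adj a w₁ := fun hadj =>
    absurd (h.left v w₁ a hvw₁ hadj.symm hva) (by simp [hva'])
  have haw₁' : ¬ B.Adj a w₁ := fun hadj =>
    absurd (h.right a w₁ d hadj hBw₁d had) (by simp [had'])
  have haw₁ne : a ≠ w₁ := by
    rintro rfl
    exact had'.2 hBw₁d
  have haw₂ne : a ≠ w₂ := by
    rintro rfl
    exact haw₁ hw₁w₂.symm
  have hBaw₂ : B.Adj a w₂ := (h.right _ _ _ hBwa.symm hBww₂ haw₂ne).resolve_left fun hadj =>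
    (h.left a w₂ w₁ hadj hw₁w₂.symm haw₁ne).elim haw₁ haw₁'
  have hvw₂ne : v ≠ w₂ := by
    rintro rfl
    exact hva'.2 hBaw₂.symm
  have hvw₂ : R.Adj v w₂ := (h.left _ _ _ hvw₁ hw₁w₂ hvw₂ne).resolve_right fun hadj =>
    absurd (h.right v w₂ a hadj hBaw₂.symm hva) (by simp [hva'])
  have h1 := htri _ _ hvw₂
  have h2 := htri _ _ hvw.symm
  obtain ⟨j, hj⟩ := hvodd
  omega

/-- A connected component of `R` has no stable set of size three. -/
theorem IsPathPair.not_stable_triple (h : IsPathPair R B) {a d v : V}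
    (hRad : R.Reachable a d) (hRav : R.Reachable a v) (had : a ≠ d) (hav : a ≠ v) (hdv : d ≠ v) :
    (R ⊔ B).Adj a d ∨ (R ⊔ B).Adj a v ∨ (R ⊔ B).Adj d v := by
  classical
  by_contra! hno
  obtain ⟨had', hav', hdv'⟩ := hno
  obtain ⟨p⟩ := hRav.symm
  obtain ⟨e, he, he1, he2⟩ := p.exists_boundary_dart
    {u | u ≠ a ∧ u ≠ d ∧ ¬ (R ⊔ B).Adj u a ∧ ¬ (R ⊔ B).Adj u d}
    ⟨hav.symm, hdv.symm, fun hadj => hav' hadj.symm, fun hadj => hdv' hadj.symm⟩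
    (fun hmem => hmem.1 rfl)
  obtain ⟨h1, h2, h3, h4⟩ := he1
  have hRv : R.Reachable a e.fst :=
    hRav.trans (p.takeUntil _ (p.dart_fst_mem_support_of_mem_darts he)).reachable
  have hsa : e.snd ≠ a := fun heq => h3 (heq ▸ Or.inl e.adj)
  have hsd : e.snd ≠ d := fun heq => h4 (heq ▸ Or.inl e.adj)
  by_cases hadj : (R ⊔ B).Adj e.snd a
  · exact h.false_of_adj_of_not_adj hRad hRv e.adj had had' h1 h3 h2 h4 hsd hadj
  · by_cases hadj' : (R ⊔ B).Adj e.snd d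
    · exact h.false_of_adj_of_not_adj hRad.symm (hRad.symm.trans hRv) e.adj had.symm
        (fun hadj => had' hadj.symm) h2 h4 h1 h3 hsa hadj'
    · exact he2 ⟨hsa, hsd, hadj, hadj'⟩

section Cobipartite

variable {C : Set V} {a d : V}

theorem IsPathPair.not_adj_of_mixed_common_neighbors (h : IsPathPair R B)
    (hα : ∀ x ∈ C, ∀ y ∈ C, ∀ z ∈ C, x ≠ y → x ≠ z → y ≠ z →
      (R ⊔ B).Adj x y ∨ (R ⊔ B).Adj x z ∨ (R ⊔ B).Adj y z)
    (ha : a ∈ C) {k₁ k₂ w₁ w₂ : V} (hw₁ : w₁ ∈ C) (hw₂ : w₂ ∈ C)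
    (hRk₁ : R.Adj a k₁) (hBk₁ : B.Adj k₁ d) (hBk₂ : B.Adj a k₂) (hRk₂ : R.Adj k₂ d)
    (hw₁d : (R ⊔ B).Adj w₁ d) (hw₂d : (R ⊔ B).Adj w₂ d) (hw₁a : ¬ (R ⊔ B).Adj w₁ a)
    (hw₂a : ¬ (R ⊔ B).Adj w₂ a) (hw₁ne : w₁ ≠ a) (hw₂ne : w₂ ≠ a)
    (hk₁ : ¬ (R ⊔ B).Adj k₁ w₁) (hk₂ : ¬ (R ⊔ B).Adj k₂ w₂) : False := by
  have ne₁₁ : k₁ ≠ w₁ := fun e => hw₁a (Or.inl (e ▸ hRk₁.symm))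
  have ne₁₂ : k₁ ≠ w₂ := fun e => hw₂a (Or.inl (e ▸ hRk₁.symm))
  have ne₂₁ : k₂ ≠ w₁ := fun e => hw₁a (Or.inr (e ▸ hBk₂.symm))
  have ne₂₂ : k₂ ≠ w₂ := fun e => hw₂a (Or.inr (e ▸ hBk₂.symm))
  have hRw₁ : R.Adj w₁ d := hw₁d.resolve_right fun e => hk₁ (h.right _ _ _ hBk₁ e.symm ne₁₁)
  have hBw₂ : B.Adj w₂ d := hw₂d.resolve_left fun e => hk₂ (h.left _ _ _ hRk₂ e.symm ne₂₂)
  have hB₁₂ : B.Adj k₁ w₂ := (h.right _ _ _ hBk₁ hBw₂.symm ne₁₂).resolve_left fun e =>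
    hw₂a (h.left _ _ _ hRk₁ e hw₂ne.symm).symm
  have hR₂₁ : R.Adj k₂ w₁ := (h.left _ _ _ hRk₂ hRw₁.symm ne₂₁).resolve_right fun e =>
    hw₁a (h.right _ _ _ hBk₂ e hw₁ne.symm).symm
  have hne : w₁ ≠ w₂ := fun e => hk₁ (Or.inr (e ▸ hB₁₂))
  rcases (hα w₁ hw₁ w₂ hw₂ a ha hne hw₁ne hw₂ne).resolve_right
    (fun e => e.elim hw₁a hw₂a) with e | e
  · exact hk₂ (h.left _ _ _ hR₂₁ e ne₂₂)
  · exact hk₁ (h.right _ _ _ hB₁₂ e.symm ne₁₁)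

theorem IsPathPair.not_adj_of_common_neighbors (h : IsPathPair R B)
    (hα : ∀ x ∈ C, ∀ y ∈ C, ∀ z ∈ C, x ≠ y → x ≠ z → y ≠ z →
      (R ⊔ B).Adj x y ∨ (R ⊔ B).Adj x z ∨ (R ⊔ B).Adj y z)
    {k l w w' : V} (hk : k ∈ C) (hl : l ∈ C) (hw : w ∈ C) (hw' : w' ∈ C)
    (hRk : R.Adj a k) (hBk : B.Adj k d) (hRl : R.Adj a l) (hBl : B.Adj l d)
    (hwa : (R ⊔ B).Adj w a) (hwd : ¬ (R ⊔ B).Adj w d) (hwne : w ≠ d)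
    (hwd' : (R ⊔ B).Adj w' d) (hwa' : ¬ (R ⊔ B).Adj w' a) (hwne' : w' ≠ a)
    (hkw : ¬ (R ⊔ B).Adj k w') (hlw : ¬ (R ⊔ B).Adj l w) : False := by
  have nekw' : k ≠ w' := fun e => hwa' (Or.inl (e ▸ hRk.symm))
  have nelw' : l ≠ w' := fun e => hwa' (Or.inl (e ▸ hRl.symm))
  have nekw : k ≠ w := fun e => hwd (Or.inr (e ▸ hBk))
  have nelw : l ≠ w := fun e => hwd (Or.inr (e ▸ hBl))
  have hww : w ≠ w' := fun e => hwa' (e ▸ hwa)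
  have hRw' : R.Adj w' d := hwd'.resolve_right fun e => hkw (h.right _ _ _ hBk e.symm nekw')
  have hBw : B.Adj w a := hwa.resolve_left fun e => hlw (h.left _ _ _ hRl.symm e.symm nelw)
  have hnww : ¬ (R ⊔ B).Adj w w' := by
    rintro (e | e)
    · exact hwd (h.left _ _ _ e hRw' hwne)
    · exact hwa' (h.right _ _ _ e.symm hBw hwne')
  have hkw₁ : (R ⊔ B).Adj k w := by
    rcases hα k hk w hw w' hw' nekw nekw' hww with e | e | e
    exacts [e, (hkw e).elim, (hnww e).elim]
  have hlw₁ : (R ⊔ B).Adj l w' := by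
    rcases hα l hl w hw w' hw' nelw nelw' hww with e | e | e
    exacts [(hlw e).elim, e, (hnww e).elim]
  have hkl : k ≠ l := fun e => hlw (e ▸ hkw₁)
  have hRkw : R.Adj k w := hkw₁.resolve_right fun e => hwd (h.right _ _ _ e.symm hBk hwne)
  have hBlw : B.Adj l w' := hlw₁.resolve_left fun e =>
    hwa' (h.left _ _ _ hRl e hwne'.symm).symm
  rcases h.left _ _ _ hRk.symm hRl hkl with e | e
  · exact hlw (h.left _ _ _ e.symm hRkw nelw)
  · exact hkw (h.right _ _ _ e hBlw nekw')

theorem IsPathPair.exists_clique_partition_of_complete (h : IsPathPair R B)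
    (hα : ∀ x ∈ C, ∀ y ∈ C, ∀ z ∈ C, x ≠ y → x ≠ z → y ≠ z →
      (R ⊔ B).Adj x y ∨ (R ⊔ B).Adj x z ∨ (R ⊔ B).Adj y z)
    (ha : a ∈ C) (hd : d ∈ C) (hne : a ≠ d) (hnadj : ¬ (R ⊔ B).Adj a d)
    (h₁ : ∀ k ∈ C, ∀ w ∈ C, R.Adj a k → B.Adj k d → (R ⊔ B).Adj w a → ¬ (R ⊔ B).Adj w d →
      w ≠ d → (R ⊔ B).Adj k w)
    (h₂ : ∀ k ∈ C, ∀ w ∈ C, B.Adj a k → R.Adj k d → (R ⊔ B).Adj w d → ¬ (R ⊔ B).Adj w a →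
      w ≠ a → (R ⊔ B).Adj k w) :
    ∃ X ⊆ C, (R ⊔ B).IsClique X ∧ (R ⊔ B).IsClique (C \ X) := by
  refine ⟨{v ∈ C | v = a ∨ ((R ⊔ B).Adj v a ∧ ¬ (R ⊔ B).Adj v d ∧ v ≠ d) ∨
    (R.Adj a v ∧ B.Adj v d)}, fun v hv => hv.1, ?_, ?_⟩
  · rintro u ⟨hu, hu'⟩ v ⟨hv, hv'⟩ huv
    rcases hu' with rfl | ⟨h3, h4, h5⟩ | ⟨h3, h4⟩ <;>
      rcases hv' with rfl | ⟨h6, h7, h8⟩ | ⟨h6, h7⟩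
    · exact (huv rfl).elim
    · exact h6.symm
    · exact Or.inl h6
    · exact h3
    · rcases hα u hu v hv d hd huv h5 h8 with e | e | e
      exacts [e, (h4 e).elim, (h7 e).elim]
    · exact (h₁ v hv u hu h6 h7 h3 h4 h5).symm
    · exact Or.inl h3.symm
    · exact h₁ u hu v hv h3 h4 h6 h7 h8
    · exact h.left _ _ _ h3.symm h6 huv
  · have key : ∀ v ∈ C \ {v ∈ C | v = a ∨ ((R ⊔ B).Adj v a ∧ ¬ (R ⊔ B).Adj v d ∧ v ≠ d) ∨
        (R.Adj a v ∧ B.Adj v d)}, v ∈ C ∧ (v = d ∨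
        ((R ⊔ B).Adj v d ∧ ¬ (R ⊔ B).Adj v a ∧ v ≠ a) ∨ (B.Adj a v ∧ R.Adj v d)) := by
      rintro v ⟨hv, hv'⟩
      refine ⟨hv, ?_⟩
      by_cases hvd : v = d
      · exact Or.inl hvd
      have hva : v ≠ a := fun e => hv' ⟨hv, Or.inl e⟩
      by_cases h3 : (R ⊔ B).Adj v d
      · by_cases h4 : (R ⊔ B).Adj v a
        · rcases h3 with e | e <;> rcases h4 with e' | e'
          · exact (hnadj (h.left _ _ _ e'.symm e hne)).elim
          · exact Or.inr (Or.inr ⟨e'.symm, e⟩)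
          · exact (hv' ⟨hv, Or.inr (Or.inr ⟨e'.symm, e⟩)⟩).elim
          · exact (hnadj (h.right _ _ _ e'.symm e hne)).elim
        · exact Or.inr (Or.inl ⟨h3, h4, hva⟩)
      · rcases hα v hv d hd a ha hvd hva hne.symm with e | e | e
        · exact (h3 e).elim
        · exact (hv' ⟨hv, Or.inr (Or.inl ⟨e, h3, hvd⟩)⟩).elim
        · exact (hnadj e.symm).elim
    intro u hu v hv huv
    obtain ⟨hu, hu'⟩ := key u hu
    obtain ⟨hv, hv'⟩ := key v hv
    rcases hu' with rfl | ⟨h3, h4, h5⟩ | ⟨h3, h4⟩ <;>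
      rcases hv' with rfl | ⟨h6, h7, h8⟩ | ⟨h6, h7⟩
    · exact (huv rfl).elim
    · exact h6.symm
    · exact Or.inl h7.symm
    · exact h3
    · rcases hα u hu v hv a ha huv h5 h8 with e | e | e
      exacts [e, (h4 e).elim, (h7 e).elim]
    · exact (h₂ v hv u hu h6 h7 h3 h4 h5).symm
    · exact Or.inl h4
    · exact h₂ u hu v hv h3 h4 h6 h7 h8
    · exact h.right _ _ _ h3.symm h6 huv

/-- Without stable sets of size three, the vertices fall into two cliques. -/
theorem IsPathPair.exists_clique_partition (h : IsPathPair R B)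
    (hα : ∀ x ∈ C, ∀ y ∈ C, ∀ z ∈ C, x ≠ y → x ≠ z → y ≠ z →
      (R ⊔ B).Adj x y ∨ (R ⊔ B).Adj x z ∨ (R ⊔ B).Adj y z) :
    ∃ X ⊆ C, (R ⊔ B).IsClique X ∧ (R ⊔ B).IsClique (C \ X) := by
  by_cases hC : (R ⊔ B).IsClique C
  · exact ⟨C, subset_rfl, hC, by simp⟩
  obtain ⟨a, ha, d, hd, hne, hnadj⟩ : ∃ a ∈ C, ∃ d ∈ C, a ≠ d ∧ ¬ (R ⊔ B).Adj a d := by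
    simpa [IsClique, Set.Pairwise] using hC
  have hα' := hα
  rw [sup_comm] at hα'
  by_cases h₁ : ∀ k ∈ C, ∀ w ∈ C, R.Adj a k → B.Adj k d → (R ⊔ B).Adj w a →
      ¬ (R ⊔ B).Adj w d → w ≠ d → (R ⊔ B).Adj k w
  · by_cases h₂ : ∀ k ∈ C, ∀ w ∈ C, B.Adj a k → R.Adj k d → (R ⊔ B).Adj w d →
        ¬ (R ⊔ B).Adj w a → w ≠ a → (R ⊔ B).Adj k w
    · exact h.exists_clique_partition_of_complete hα ha hd hne hnadj h₁ h₂
    · push Not at h₂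
      obtain ⟨k, hk, w, hw, hBk, hRk, h3, h4, h5, h6⟩ := h₂
      rw [sup_comm]
      refine h.symm.exists_clique_partition_of_complete hα' ha hd hne (sup_comm R B ▸ hnadj) ?_ ?_
      · rw [sup_comm]
        intro l hl u hu hBl hRl h7 h8 h9
        by_contra h10
        rw [sup_comm] at *
        exact h.symm.not_adj_of_common_neighbors hα hk hl hu hw hBk hRk hBl hRl h7 h8 h9 h3 h4 h5
          h6 h10
      · rw [sup_comm]
        intro l hl u hu hBl hRl h7 h8 h9
        by_contra h10
        exact h.not_adj_of_mixed_common_neighbors hα ha hu hw hBl hRl hBk hRk h7 h3 h8 h4 h9 h5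
          h10 h6
  · push Not at h₁
    obtain ⟨k, hk, w, hw, hRk, hBk, h3, h4, h5, h6⟩ := h₁
    rw [sup_comm]
    refine h.symm.exists_clique_partition_of_complete hα' ha hd hne (sup_comm R B ▸ hnadj) ?_ ?_
    · rw [sup_comm]
      intro l hl u hu hBl hRl h7 h8 h9
      by_contra h10
      exact h.not_adj_of_mixed_common_neighbors hα hd hu hw hRl.symm hBl.symm hBk.symm hRk.symm
          h7 h3 h8 h4 h9 h5 h10 h6
    · rw [sup_comm]
      intro l hl u hu hRl hBl h7 h8 h9
      by_contra h10
      exact h.not_adj_of_common_neighbors hα hl hk hw hu hRl hBl hRk hBk h3 h4 h5 h7 h8 h9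
          h10 h6

end Cobipartite

section Component

variable {C P : Set V}

/-- If all edges between a nonempty set `P` and its complement in a component of `R` belong to `R`,
then `P` dominates the component. -/
theorem IsPathPair.exists_adj_of_notMem (h : IsPathPair R B)
    (hconn : ∀ u ∈ C, ∀ v ∈ C, R.Reachable u v) (hcl : ∀ u ∈ C, ∀ v, R.Adj u v → v ∈ C)
    (hPC : P ⊆ C) (hP : P.Nonempty)
    (hcross : ∀ u ∈ P, ∀ v ∈ C \ P, (R ⊔ B).Adj u v → R.Adj u v) {v : V} (hv : v ∈ C \ P) :
    ∃ x ∈ P, R.Adj x v := by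
  obtain ⟨x₀, hx₀⟩ := hP
  obtain ⟨p⟩ := hconn x₀ (hPC hx₀) v hv.1
  by_contra! hno
  obtain ⟨e, -, he1, he2⟩ := p.exists_boundary_dart {u | u ∈ P ∨ (u ∈ C ∧ ∃ x ∈ P, R.Adj x u)}
    (Or.inl hx₀) (fun hmem => hmem.elim hv.2 fun ⟨_, x, hx, hxv⟩ => hno x hx hxv)
  rcases he1 with he1 | ⟨heC, x, hx, hxe⟩
  · exact he2 (Or.inr ⟨hcl _ (hPC he1) _ e.adj, _, he1, e.adj⟩)
  · by_cases hsP : e.snd ∈ P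
    · exact he2 (Or.inl hsP)
    · have hsC := hcl _ heC _ e.adj
      refine he2 (Or.inr ⟨hsC, x, hx, hcross x hx _ ⟨hsC, hsP⟩ ?_⟩)
      exact h.left _ _ _ hxe e.adj fun heq => hsP (heq ▸ hx)

/-- If a clique `P` with clique complement can be split such that all edges across the split belong
to `R`, then the whole component is a clique. -/
theorem IsPathPair.isClique_of_split (h : IsPathPair R B)
    (hconn : ∀ u ∈ C, ∀ v ∈ C, R.Reachable u v) (hcl : ∀ u ∈ C, ∀ v, R.Adj u v → v ∈ C)
    (hPC : P ⊆ C) (hP : (R ⊔ B).IsClique P) (hQ : (R ⊔ B).IsClique (C \ P))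
    (hcross : ∀ u ∈ P, ∀ v ∈ C \ P, (R ⊔ B).Adj u v → R.Adj u v) (S : Set V)
    (h1 : (P ∩ S).Nonempty) (h2 : (P \ S).Nonempty)
    (hS : ∀ u ∈ P ∩ S, ∀ v ∈ P \ S, R.Adj u v) : (R ⊔ B).IsClique C := by
  have hstep : ∀ z ∈ P, ∀ z' ∈ P, ∀ y ∈ C \ P, R.Adj z z' → R.Adj z y → R.Adj z' y :=
    fun z _ z' hz' y hy hzz hzy => hcross _ hz' _ hy
      (h.left _ _ _ hzz.symm hzy fun e => hy.2 (e ▸ hz'))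
  have hfull : ∀ x ∈ P, ∀ y ∈ C \ P, R.Adj x y := by
    intro x hx y hy
    obtain ⟨z, hz, hzy⟩ := h.exists_adj_of_notMem hconn hcl hPC (h1.mono Set.inter_subset_left)
      hcross hy
    obtain ⟨s, hs⟩ := h1
    obtain ⟨t, ht⟩ := h2
    by_cases hzS : z ∈ S <;> by_cases hxS : x ∈ S
    · exact hstep t ht.1 x hx y hy (hS x ⟨hx, hxS⟩ t ht).symm
        (hstep z hz t ht.1 y hy (hS z ⟨hz, hzS⟩ t ht) hzy)
    · exact hstep z hz x hx y hy (hS z ⟨hz, hzS⟩ x ⟨hx, hxS⟩) hzy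
    · exact hstep z hz x hx y hy (hS x ⟨hx, hxS⟩ z ⟨hz, hzS⟩).symm hzy
    · exact hstep s hs.1 x hx y hy (hS s hs x ⟨hx, hxS⟩)
        (hstep z hz s hs.1 y hy (hS s hs z ⟨hz, hzS⟩).symm hzy)
  intro u hu v hv huv
  by_cases huP : u ∈ P <;> by_cases hvP : v ∈ P
  · exact hP huP hvP huv
  · exact Or.inl (hfull u huP v ⟨hv, hvP⟩)
  · exact Or.inl (hfull v hvP u ⟨hu, huP⟩).symm
  · exact hQ ⟨hu, huP⟩ ⟨hv, hvP⟩ huv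

theorem IsPathPair.isClique_neighbors (h : IsPathPair R B) (hcl : ∀ u ∈ C, ∀ v, R.Adj u v → v ∈ C)
    {o : V} (ho : o ∉ C) : (R ⊔ B).IsClique {v ∈ C | (R ⊔ B).Adj o v} := by
  rintro u ⟨hu, hou⟩ v ⟨hv, hov⟩ huv
  have key : ∀ u ∈ C, (R ⊔ B).Adj o u → B.Adj o u := fun u hu hou =>
    hou.resolve_left fun e => ho (hcl u hu o e.symm)
  exact h.right _ _ _ (key u hu hou).symm (key v hv hov) huv

theorem IsPathPair.cross_adj (h : IsPathPair R B) (hcl : ∀ u ∈ C, ∀ v, R.Adj u v → v ∈ C)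
    {o : V} (ho : o ∉ C) {u v : V} (hu : u ∈ {v ∈ C | (R ⊔ B).Adj o v})
    (hv : v ∈ C \ {v ∈ C | (R ⊔ B).Adj o v}) : ¬ B.Adj u v := by
  intro e
  have hou : B.Adj o u := hu.2.resolve_left fun e => ho (hcl u hu.1 o e.symm)
  exact hv.2 ⟨hv.1, h.right _ _ _ hou e fun e => ho (e ▸ hv.1)⟩

/-- The vertices of a component of `R` missed by an outside vertex form a clique. -/
theorem IsPathPair.isClique_nonneighbors (h : IsPathPair R B)
    (hconn : ∀ u ∈ C, ∀ v ∈ C, R.Reachable u v) (hcl : ∀ u ∈ C, ∀ v, R.Adj u v → v ∈ C)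
    {o : V} (ho : o ∉ C) (hX : {v ∈ C | (R ⊔ B).Adj o v}.Nonempty) :
    (R ⊔ B).IsClique (C \ {v ∈ C | (R ⊔ B).Adj o v}) := by
  set X := {v ∈ C | (R ⊔ B).Adj o v} with hXdef
  have hnB : ∀ u ∈ X, ∀ v ∈ C \ X, ¬ B.Adj u v := fun u hu v hv => h.cross_adj hcl ho hu hv
  have hcross : ∀ u ∈ X, ∀ v ∈ C \ X, (R ⊔ B).Adj u v → R.Adj u v := fun u hu v hv e =>
    e.resolve_right (hnB u hu v hv)
  have hBY : ∀ u ∈ C, ∀ v ∈ C \ X, B.Adj u v → u ∈ C \ X := fun u hu v hv e =>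
    ⟨hu, fun hu' => hnB u hu' v hv e⟩
  have hsame : ∀ y ∈ C \ X, ∀ w ∈ C \ X, R.Adj y w → ∀ x ∈ X, R.Adj x y → R.Adj x w :=
    fun y _ w hw hyw x hx hxy => hcross x hx w hw
      (h.left _ _ _ hxy hyw fun e => hw.2 (e ▸ hx))
  have key : ∀ n, ∀ y ∈ C \ X, ∀ y' ∈ C \ X, y ≠ y' → R.dist y y' = n → (R ⊔ B).Adj y y' := by
    intro n
    induction n using Nat.strong_induction_on with
    | _ n ih =>
    intro y hy y' hy' hne hn
    by_contra hnadj
    have hreach := hconn y hy.1 y' hy'.1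
    have hodd : ¬ Even n := fun he => hnadj (Or.inr (h.adj_of_even_dist hreach hne (hn ▸ he)))
    obtain ⟨k, hk⟩ := Nat.not_even_iff_odd.1 hodd
    have hk0 : k ≠ 0 := by
      rintro rfl
      exact hnadj (Or.inl (dist_eq_one_iff_adj.1 (hn.trans hk)))
    obtain ⟨w₁, -, hw₁, hyw₁, hd₁⟩ := hreach.exists_dist_eq (a := 1) (b := 2 * k) (by omega)
    obtain ⟨w₂, -, hw₂, hw₁w₂, hd₂⟩ := hw₁.exists_dist_eq (a := 1) (b := 2 * k - 1) (by omega)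
    rw [dist_eq_one_iff_adj] at hyw₁ hw₁w₂
    have hw₁ne : w₁ ≠ y' := by
      rintro rfl
      simp at hd₁
      omega
    have hw₂ne : w₂ ≠ y' := by
      rintro rfl
      simp at hd₂
      omega
    have hw₁Y : w₁ ∈ C \ X := hBY w₁ (hcl _ hy.1 _ hyw₁) y' hy'
      (h.adj_of_even_dist hw₁ hw₁ne (hd₁ ▸ even_two_mul k))
    have hyw₂ne : y ≠ w₂ := by
      rintro rfl
      omega
    have hByw₂ : B.Adj y w₂ := (h.left _ _ _ hyw₁ hw₁w₂ hyw₂ne).resolve_left fun e => by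
      have := e.reachable.dist_triangle_left y'
      rw [dist_eq_one_iff_adj.2 e] at this
      omega
    have hw₂Y : w₂ ∈ C \ X := hBY w₂ (hcl _ hw₁Y.1 _ hw₁w₂) y hy hByw₂.symm
    rcases ih _ (by omega) w₂ hw₂Y y' hy' hw₂ne hd₂ with e | e
    · obtain ⟨x, hx, hxy⟩ := h.exists_adj_of_notMem hconn hcl (fun v hv => hv.1) hX hcross hy
      have hxy' := hsame _ hw₂Y _ hy' e x hx
        (hsame _ hw₁Y _ hw₂Y hw₁w₂ x hx (hsame _ hy _ hw₁Y hyw₁ x hx hxy))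
      exact hnadj (h.left _ _ _ hxy.symm hxy' hne)
    · exact hnadj (h.right _ _ _ hByw₂ e hne)
  exact fun y hy y' hy' hne => key _ y hy y' hy' hne rfl

/-- A component of `R` that is not a clique splits into two cliques, and every outside vertex sees
nothing of it or exactly one of these cliques. -/
theorem IsPathPair.exists_component_partition (h : IsPathPair R B)
    (hconn : ∀ u ∈ C, ∀ v ∈ C, R.Reachable u v) (hcl : ∀ u ∈ C, ∀ v, R.Adj u v → v ∈ C)
    (hC : ¬ (R ⊔ B).IsClique C) :
    ∃ X ⊆ C, (R ⊔ B).IsClique X ∧ (R ⊔ B).IsClique (C \ X) ∧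
      ∀ o ∉ C, {v ∈ C | (R ⊔ B).Adj o v} = ∅ ∨ {v ∈ C | (R ⊔ B).Adj o v} = X ∨
        {v ∈ C | (R ⊔ B).Adj o v} = C \ X := by
  by_cases hout : ∃ o ∉ C, {v ∈ C | (R ⊔ B).Adj o v}.Nonempty
  · obtain ⟨o, ho, hX⟩ := hout
    set X := {v ∈ C | (R ⊔ B).Adj o v} with hXdef
    have hXC : X ⊆ C := fun v hv => hv.1
    have hXcl : (R ⊔ B).IsClique X := h.isClique_neighbors hcl ho
    have hYcl : (R ⊔ B).IsClique (C \ X) := h.isClique_nonneighbors hconn hcl ho hX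
    have hcross : ∀ u ∈ X, ∀ v ∈ C \ X, (R ⊔ B).Adj u v → R.Adj u v := fun u hu v hv e =>
      e.resolve_right (h.cross_adj hcl ho hu hv)
    have hCX : C \ (C \ X) = X := Set.sdiff_sdiff_cancel_left hXC
    refine ⟨X, hXC, hXcl, hYcl, fun o' ho' => ?_⟩
    set X' := {v ∈ C | (R ⊔ B).Adj o' v} with hX'def
    have hX'C : X' ⊆ C := fun v hv => hv.1
    have hsplit : ∀ P ⊆ C, (R ⊔ B).IsClique P → ∀ u ∈ P ∩ X', ∀ v ∈ P \ X', R.Adj u v :=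
      fun P hP hPcl u hu v hv => (hPcl hu.1 hv.1 fun e => hv.2 (e ▸ hu.2)).resolve_right
        (h.cross_adj hcl ho' hu.2 ⟨hP hv.1, hv.2⟩)
    have h1 : X ∩ X' = ∅ ∨ X \ X' = ∅ := by
      by_contra! hno
      exact hC (h.isClique_of_split hconn hcl hXC hXcl hYcl hcross X' hno.1 hno.2
        (hsplit X hXC hXcl))
    have h2 : (C \ X) ∩ X' = ∅ ∨ (C \ X) \ X' = ∅ := by
      by_contra! hno
      refine hC (h.isClique_of_split hconn hcl Set.sdiff_subset hYcl (by rwa [hCX]) ?_ X' hno.1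
        hno.2 (hsplit _ Set.sdiff_subset hYcl))
      rw [hCX]
      exact fun u hu v hv e => (hcross v hv u hu e.symm).symm
    rw [Set.sdiff_eq_empty] at h1 h2
    rcases h1 with h1 | h1 <;> rcases h2 with h2 | h2
    · left
      ext v
      constructor
      · intro hv
        by_cases hvX : v ∈ X
        · exact h1 ▸ (⟨hvX, hv⟩ : v ∈ X ∩ X')
        · exact h2 ▸ (⟨⟨hX'C hv, hvX⟩, hv⟩ : v ∈ (C \ X) ∩ X')
      · exact fun hv => hv.elim
    · right; right
      refine subset_antisymm (fun v hv => ⟨hX'C hv, fun hvX => ?_⟩) h2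
      exact (h1 ▸ (⟨hvX, hv⟩ : v ∈ X ∩ X') : v ∈ (∅ : Set V))
    · right; left
      refine subset_antisymm (fun v hv => ?_) h1
      by_contra hvX
      exact (h2 ▸ (⟨⟨hX'C hv, hvX⟩, hv⟩ : v ∈ (C \ X) ∩ X') : v ∈ (∅ : Set V))
    · refine (hC ?_).elim
      have : C ⊆ X' := fun v hv => by
        by_cases hvX : v ∈ X
        · exact h1 hvX
        · exact h2 ⟨hv, hvX⟩
      exact (h.isClique_neighbors hcl ho').subset this
  · push Not at hout
    obtain ⟨X, hXC, hX, hY⟩ := h.exists_clique_partition (C := C)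
      fun x hx y hy z hz hxy hxz hyz =>
        h.not_stable_triple (hconn x hx y hy) (hconn x hx z hz) hxy hxz hyz
    exact ⟨X, hXC, hX, hY, fun o ho => Or.inl (hout o ho)⟩

end Component

end SimpleGraph

theorem biUnion_sideLists_comm {V : Type*} [DecidableEq V] {A B : Finset V} (hAB : Disjoint A B)
    (L : V → Finset ℕ) (D E : Finset ℕ) {T : Finset V} (hT : T ⊆ A ∪ B) :
    T.biUnion (sideLists B L E D) = T.biUnion (sideLists A L D E) := by
  refine Finset.biUnion_congr rfl fun v hv => ?_
  have h1 : v ∈ A → v ∉ B := fun h h' => Finset.disjoint_left.1 hAB h h'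
  have h2 := Finset.mem_union.1 (hT hv)
  by_cases hA : v ∈ A
  · simp [sideLists, hA, h1 hA]
  · simp [sideLists, hA, h2.resolve_left hA]

namespace SimpleGraph

variable {V : Type*} {R B : SimpleGraph V}

section Reduction

/-- Make `C` a clique of `R` and then isolate the vertices of `Z`. -/
def completeOff (R : SimpleGraph V) (C Z : Finset V) : SimpleGraph V where
  Adj a b := a ∉ Z ∧ b ∉ Z ∧ a ≠ b ∧ (R.Adj a b ∨ (a ∈ C ∧ b ∈ C))
  symm := ⟨fun _ _ h => ⟨h.2.1, h.1, h.2.2.1.symm, h.2.2.2.imp (fun e => e.symm) And.symm⟩⟩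
  loopless := ⟨fun _ h => h.2.2.1 rfl⟩

theorem IsPathPair.completeOff (h : IsPathPair R B) {C : Finset V}
    (hcl : ∀ u ∈ C, ∀ v, R.Adj u v → v ∈ C) (Z : Finset V) :
    IsPathPair (R.completeOff C Z) (B.completeOff ∅ Z) := by
  have key : ∀ a c, a ∉ Z → c ∉ Z → a ≠ c → (R ⊔ B).Adj a c →
      (R.completeOff C Z ⊔ B.completeOff ∅ Z).Adj a c := fun a c ha hc hne hadj =>
    hadj.imp (fun e => ⟨ha, hc, hne, Or.inl e⟩) (fun e => ⟨ha, hc, hne, Or.inl e⟩)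
  constructor
  · rintro a b c ⟨ha, hb, -, hab⟩ ⟨-, hc, -, hbc⟩ hne
    rcases hab with hab | hab <;> rcases hbc with hbc | hbc
    · exact key a c ha hc hne (h.left _ _ _ hab hbc hne)
    · exact Or.inl ⟨ha, hc, hne, Or.inr ⟨hcl _ hbc.1 _ hab.symm, hbc.2⟩⟩
    · exact Or.inl ⟨ha, hc, hne, Or.inr ⟨hab.1, hcl _ hab.2 _ hbc⟩⟩
    · exact Or.inl ⟨ha, hc, hne, Or.inr ⟨hab.1, hbc.2⟩⟩
  · rintro a b c ⟨ha, hb, -, hab⟩ ⟨-, hc, -, hbc⟩ hne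
    simp only [Finset.notMem_empty, and_self, or_false] at hab hbc
    exact key a c ha hc hne (h.right _ _ _ hab hbc hne)

variable [DecidableEq V] {X Y : Finset V} {N : ℕ}

theorem card_le_of_isClique_completeOff
    (hN : ∀ s : Finset V, (R ⊔ B).IsClique (s : Set V) → s.card ≤ N)
    (hX : (R ⊔ B).IsClique (X : Set V)) (hY : (R ⊔ B).IsClique (Y : Set V))
    (hout : ∀ o ∉ X ∪ Y, (∀ v ∈ X ∪ Y, ¬ (R ⊔ B).Adj o v) ∨
      (∀ v ∈ X ∪ Y, (R ⊔ B).Adj o v ↔ v ∈ X) ∨ (∀ v ∈ X ∪ Y, (R ⊔ B).Adj o v ↔ v ∈ Y))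
    (Z : Finset V) (hZ : ((X ∪ Y) \ Z).card ≤ N) (s : Finset V)
    (hs : (R.completeOff (X ∪ Y) Z ⊔ B.completeOff ∅ Z).IsClique (s : Set V)) : s.card ≤ N := by
  have hmem : ∀ a b, (R.completeOff (X ∪ Y) Z ⊔ B.completeOff ∅ Z).Adj a b →
      a ∉ Z ∧ ((R ⊔ B).Adj a b ∨ (a ∈ X ∪ Y ∧ b ∈ X ∪ Y)) := by
    rintro a b (e | e)
    · exact ⟨e.1, e.2.2.2.imp_left Or.inl⟩
    · exact ⟨e.1, Or.inl (Or.inr (by simpa using e.2.2.2))⟩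
  by_cases hsZ : ∃ z ∈ s, z ∈ Z
  · obtain ⟨z, hz, hzZ⟩ := hsZ
    have h1 : s ⊆ {z} := by
      intro v hv
      rw [Finset.mem_singleton]
      by_contra hne
      exact (hmem z v (hs hz hv (Ne.symm hne))).1 hzZ
    exact (Finset.card_le_card h1).trans (hN {z} (by simp))
  push Not at hsZ
  by_cases hsC : s ⊆ X ∪ Y
  · exact (Finset.card_le_card fun v hv => Finset.mem_sdiff.2 ⟨hsC hv, hsZ v hv⟩).trans hZ
  · obtain ⟨o, ho, hoC⟩ := Finset.not_subset.1 hsC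
    refine hN s fun u hu v hv huv => ?_
    rcases (hmem u v (hs hu hv huv)).2 with e | ⟨huC, hvC⟩
    · exact e
    · have ho' : ∀ v ∈ s, v ∈ X ∪ Y → (R ⊔ B).Adj o v := fun v hv hvC =>
        (hmem o v (hs ho hv fun e => hoC (e ▸ hvC))).2.resolve_right fun e => hoC e.1
      rcases hout o hoC with h1 | h1 | h1
      · exact (h1 u huC (ho' u hu huC)).elim
      · exact hX ((h1 u huC).1 (ho' u hu huC)) ((h1 v hvC).1 (ho' v hv hvC)) huv
      · exact hY ((h1 u huC).1 (ho' u hu huC)) ((h1 v hvC).1 (ho' v hv hvC)) huv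

/-- The outside neighbours of a clique `X` that all see the whole of `X` are few. -/
theorem IsPathPair.card_image_outside_le (h : IsPathPair R B) {C : Finset V}
    (hcl : ∀ u ∈ C, ∀ v, R.Adj u v → v ∈ C)
    (hN : ∀ s : Finset V, (R ⊔ B).IsClique (s : Set V) → s.card ≤ N)
    (hXC : X ⊆ C) (hX : (R ⊔ B).IsClique (X : Set V)) (hXne : X.Nonempty)
    (P : Finset V) (hP : ∀ o ∈ P, o ∉ C ∧ ∀ v ∈ X, (R ⊔ B).Adj o v) (c : V → ℕ) :
    (P.image c).card + X.card ≤ N := by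
  have hdisj : Disjoint P X := Finset.disjoint_left.2 fun v hv hv' => (hP v hv).1 (hXC hv')
  have h1 := hN (P ∪ X) (by
    rw [Finset.coe_union]
    obtain ⟨z, hz⟩ := hXne
    have hB : ∀ o ∈ P, B.Adj o z := fun o ho => ((hP o ho).2 z hz).resolve_left fun e =>
      (hP o ho).1 (hcl z (hXC hz) o e.symm)
    rintro u (hu | hu) v (hv | hv) huv
    · exact h.right _ _ _ (hB u hu) (hB v hv).symm huv
    · exact (hP u hu).2 v hv
    · exact ((hP v hv).2 u hu).symm
    · exact hX hu hv huv)
  rw [Finset.card_union_of_disjoint hdisj] at h1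
  exact (Nat.add_le_add_right Finset.card_image_le _).trans h1

end Reduction

end SimpleGraph

/-- A union of two cliques `X` and `Y` containing the disjoint non-edges `x i, y i` is colourable
from its lists, once Hall's condition with excess holds for the remaining vertices. -/
theorem exists_coloring_of_pairs {V ι : Type*} [DecidableEq V] [DecidableEq ι] [Nonempty ι]
    (G : SimpleGraph V) {X Y : Finset V} (hXY : Disjoint X Y) (I : Finset ι) (x y : ι → V)
    (hx : ∀ i ∈ I, x i ∈ X) (hy : ∀ i ∈ I, y i ∈ Y) (hxinj : Set.InjOn x I)
    (hyinj : Set.InjOn y I) (hxy : ∀ i ∈ I, ¬ G.Adj (x i) (y i)) (L : V → Finset ℕ)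
    (D E : Finset ℕ) (hD : ∀ v ∈ X, X.card ≤ (L v \ D).card) (hE : ∀ v ∈ Y, Y.card ≤ (L v \ E).card)
    (hT : ∀ T ⊆ (X \ I.image x) ∪ (Y \ I.image y), T.Nonempty →
      T.card + I.card ≤ (T.biUnion (sideLists (X \ I.image x) L D E)).card) :
    ∃ d : V → ℕ, (∀ v ∈ X, d v ∈ L v \ D) ∧ (∀ v ∈ Y, d v ∈ L v \ E) ∧
      ∀ u ∈ X ∪ Y, ∀ v ∈ X ∪ Y, G.Adj u v → d u ≠ d v := by
  have hxX : I.image x ⊆ X := Finset.image_subset_iff.2 hx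
  have hyY : I.image y ⊆ Y := Finset.image_subset_iff.2 hy
  have hcx : (I.image x).card = I.card := Finset.card_image_of_injOn hxinj
  have hcy : (I.image y).card = I.card := Finset.card_image_of_injOn hyinj
  have hdisj : Disjoint (X \ I.image x) (Y \ I.image y) :=
    Finset.disjoint_of_subset_left Finset.sdiff_subset
      (Finset.disjoint_of_subset_right Finset.sdiff_subset hXY)
  have hIX := Finset.card_le_card hxX
  have hIY := Finset.card_le_card hyY
  have hρ : ((X \ I.image x) ∪ (Y \ I.image y)).card + 2 * I.card ≤ X.card + Y.card := by
    rw [Finset.card_union_of_disjoint hdisj, Finset.card_sdiff_of_subset hxX,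
      Finset.card_sdiff_of_subset hyY]
    omega
  obtain ⟨c, cx, cy, h1, h2, h3, h4, h5, h6, h7⟩ := exists_pair_representatives
    ((X \ I.image x) ∪ (Y \ I.image y)) I (sideLists (X \ I.image x) L D E)
    (fun i => L (x i) \ D) (fun i => L (y i) \ E) X.card Y.card (fun i hi => hD _ (hx i hi))
    (fun i hi => hE _ (hy i hi)) (by omega) (by omega) hρ hT
  let d : V → ℕ := fun v => if v ∈ I.image x then cx (Function.invFunOn x I v)
    else if v ∈ I.image y then cy (Function.invFunOn y I v) else c v
  have hdx : ∀ i ∈ I, d (x i) = cx i := fun i hi => by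
    simp only [d, if_pos (Finset.mem_image_of_mem x hi)]
    rw [hxinj.leftInvOn_invFunOn hi]
  have hdy : ∀ i ∈ I, d (y i) = cy i := fun i hi => by
    have hn : y i ∉ I.image x := fun h =>
      Finset.disjoint_left.1 hXY (hxX h) (hy i hi)
    simp only [d, if_neg hn, if_pos (Finset.mem_image_of_mem y hi)]
    rw [hyinj.leftInvOn_invFunOn hi]
  have hdc : ∀ v ∈ (X \ I.image x) ∪ (Y \ I.image y), d v = c v := fun v hv => by
    have hnx : v ∉ I.image x := fun h => by
      rcases Finset.mem_union.1 hv with hv | hv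
      · exact (Finset.mem_sdiff.1 hv).2 h
      · exact Finset.disjoint_left.1 hXY (hxX h) (Finset.mem_sdiff.1 hv).1
    have hny : v ∉ I.image y := fun h => by
      rcases Finset.mem_union.1 hv with hv | hv
      · exact Finset.disjoint_left.1 hXY (Finset.mem_sdiff.1 hv).1 (hyY h)
      · exact (Finset.mem_sdiff.1 hv).2 h
    simp only [d, if_neg hnx, if_neg hny]
  have hcases : ∀ v ∈ X ∪ Y, (∃ i ∈ I, v = x i) ∨ (∃ i ∈ I, v = y i) ∨
      v ∈ (X \ I.image x) ∪ (Y \ I.image y) := fun v hv => by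
    by_cases hvx : v ∈ I.image x
    · obtain ⟨i, hi, rfl⟩ := Finset.mem_image.1 hvx
      exact Or.inl ⟨i, hi, rfl⟩
    by_cases hvy : v ∈ I.image y
    · obtain ⟨i, hi, rfl⟩ := Finset.mem_image.1 hvy
      exact Or.inr (Or.inl ⟨i, hi, rfl⟩)
    · refine Or.inr (Or.inr ?_)
      simp only [Finset.mem_union, Finset.mem_sdiff] at hv ⊢
      tauto
  refine ⟨d, fun v hv => ?_, fun v hv => ?_, fun u hu v hv huv => ?_⟩
  · rcases hcases v (Finset.mem_union_left _ hv) with ⟨i, hi, rfl⟩ | ⟨i, hi, rfl⟩ | hvc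
    · exact hdx i hi ▸ (h2 i hi).1
    · exact (Finset.disjoint_left.1 hXY hv (hy i hi)).elim
    · have hvA : v ∈ X \ I.image x := (Finset.mem_union.1 hvc).resolve_right fun h =>
        Finset.disjoint_left.1 hXY hv (Finset.mem_sdiff.1 h).1
      have := h1 v hvc
      rwa [sideLists, if_pos hvA, ← hdc v hvc] at this
  · rcases hcases v (Finset.mem_union_right _ hv) with ⟨i, hi, rfl⟩ | ⟨i, hi, rfl⟩ | hvc
    · exact (Finset.disjoint_left.1 hXY (hx i hi) hv).elim
    · exact hdy i hi ▸ (h2 i hi).2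
    · have hvA : v ∉ X \ I.image x := fun h =>
        Finset.disjoint_left.1 hXY (Finset.mem_sdiff.1 h).1 hv
      have := h1 v hvc
      rwa [sideLists, if_neg hvA, ← hdc v hvc] at this
  · rcases hcases u hu with ⟨i, hi, rfl⟩ | ⟨i, hi, rfl⟩ | huc <;>
      rcases hcases v hv with ⟨j, hj, rfl⟩ | ⟨j, hj, rfl⟩ | hvc
    · rw [hdx i hi, hdx j hj]
      exact fun e => huv.ne (congrArg x (h4 hi hj e))
    · rw [hdx i hi, hdy j hj]
      exact h7 i hi j hj fun e => hxy i hi (e ▸ huv)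
    · rw [hdx i hi, hdc v hvc]
      exact (h6 v hvc i hi).1.symm
    · rw [hdy i hi, hdx j hj]
      exact (h7 j hj i hi fun e => hxy i hi (e ▸ huv.symm)).symm
    · rw [hdy i hi, hdy j hj]
      exact fun e => huv.ne (congrArg y (h5 hi hj e))
    · rw [hdy i hi, hdc v hvc]
      exact (h6 v hvc i hi).2.symm
    · rw [hdc u huc, hdx j hj]
      exact (h6 u huc j hj).1
    · rw [hdc u huc, hdy j hj]
      exact (h6 u huc j hj).2
    · rw [hdc u huc, hdc v hvc]
      exact fun e => huv.ne (h3 huc hvc e)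

namespace SimpleGraph

/-- The number of vertices having a neighbour. -/
noncomputable def nonisolatedCard {V : Type*} (G : SimpleGraph V) : ℕ :=
  {v | ∃ w, G.Adj v w}.ncard

section Step

variable {V : Type*} [Fintype V] [DecidableEq V] {R B : SimpleGraph V}

/-- The reduction step: the graph obtained by completing `X ∪ Y` minus half of a set of disjoint
non-edges is coloured first, with `M` as the list of the other halves. -/
theorem IsPathPair.exists_coloring_step (h : IsPathPair R B) {N : ℕ}
    (hN : ∀ s : Finset V, (R ⊔ B).IsClique (s : Set V) → s.card ≤ N)
    (L : V → Finset ℕ) (hL : ∀ v, N ≤ (L v).card) {X Y : Finset V} (hXY : Disjoint X Y)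
    (hX : (R ⊔ B).IsClique (X : Set V)) (hY : (R ⊔ B).IsClique (Y : Set V))
    (hcl : ∀ u ∈ X ∪ Y, ∀ v, R.Adj u v → v ∈ X ∪ Y)
    (hout : ∀ o ∉ X ∪ Y, (∀ v ∈ X ∪ Y, ¬ (R ⊔ B).Adj o v) ∨
      (∀ v ∈ X ∪ Y, (R ⊔ B).Adj o v ↔ v ∈ X) ∨ (∀ v ∈ X ∪ Y, (R ⊔ B).Adj o v ↔ v ∈ Y))
    (hiso : ∀ u ∈ X ∪ Y, ∃ v, (R ⊔ B).Adj u v)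
    (I : Finset V) (hI : I.Nonempty) (x y : V → V)
    (hx : ∀ i ∈ I, x i ∈ X) (hy : ∀ i ∈ I, y i ∈ Y) (hxinj : Set.InjOn x I)
    (hyinj : Set.InjOn y I) (hxy : ∀ i ∈ I, ¬ (R ⊔ B).Adj (x i) (y i))
    (hcard : X.card + Y.card = N + I.card)
    (M : Finset ℕ) (hM : N ≤ M.card)
    (hph : ∀ D E : Finset ℕ, D.card ≤ (Y \ I.image y).card → E.card ≤ (X \ I.image x).card →
      (∃ T ⊆ (X \ I.image x) ∪ (Y \ I.image y), T.Nonempty ∧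
        (T.biUnion (sideLists (X \ I.image x) L D E)).card < T.card + I.card) →
      ∃ T ⊆ (X \ I.image x) ∪ (Y \ I.image y), T.Nonempty ∧
        (T.biUnion (sideLists (X \ I.image x) L D E)).card < T.card + I.card ∧
        M \ D ⊆ T.biUnion (sideLists (X \ I.image x) L D E))
    (ih : ∀ R' B' : SimpleGraph V, IsPathPair R' B' →
      (R' ⊔ B').nonisolatedCard < (R ⊔ B).nonisolatedCard →
      (∀ s : Finset V, (R' ⊔ B').IsClique (s : Set V) → s.card ≤ N) →
      ∀ L' : V → Finset ℕ, (∀ v, N ≤ (L' v).card) →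
      ∃ c : V → ℕ, (∀ v, c v ∈ L' v) ∧ ∀ a b, (R' ⊔ B').Adj a b → c a ≠ c b) :
    ∃ c : V → ℕ, (∀ v, c v ∈ L v) ∧ ∀ a b, (R ⊔ B).Adj a b → c a ≠ c b := by
  have hxX : I.image x ⊆ X := Finset.image_subset_iff.2 hx
  have hyY : I.image y ⊆ Y := Finset.image_subset_iff.2 hy
  have hcx : (I.image x).card = I.card := Finset.card_image_of_injOn hxinj
  have hcy : (I.image y).card = I.card := Finset.card_image_of_injOn hyinj
  obtain ⟨i₀, hi₀⟩ := hI
  have hXne : X.Nonempty := ⟨_, hx _ hi₀⟩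
  have hYne : Y.Nonempty := ⟨_, hy _ hi₀⟩
  have hXN := hN X hX
  have hYN := hN Y hY
  have hIX := Finset.card_le_card hxX
  have hIY := Finset.card_le_card hyY
  have hnoty : ∀ v ∈ X, v ∉ I.image y := fun v hv h =>
    Finset.disjoint_left.1 hXY hv (hyY h)
  have hnotx : ∀ v ∈ Y, v ∉ I.image x := fun v hv h =>
    Finset.disjoint_left.1 hXY (hxX h) hv
  have hadj : ∀ a b, a ∉ I.image y → b ∉ I.image y → a ≠ b →
      ((R ⊔ B).Adj a b ∨ (a ∈ X ∪ Y ∧ b ∈ X ∪ Y)) →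
      (R.completeOff (X ∪ Y) (I.image y) ⊔ B.completeOff ∅ (I.image y)).Adj a b := by
    rintro a b ha hb hne ((e | e) | e)
    · exact Or.inl ⟨ha, hb, hne, Or.inl e⟩
    · exact Or.inr ⟨ha, hb, hne, Or.inl e⟩
    · exact Or.inl ⟨ha, hb, hne, Or.inr e⟩
  have hlt : (R.completeOff (X ∪ Y) (I.image y) ⊔ B.completeOff ∅ (I.image y)).nonisolatedCard <
      (R ⊔ B).nonisolatedCard := by
    refine Set.ncard_lt_ncard (Set.ssubset_iff_of_subset ?_ |>.2 ⟨y i₀, ?_, ?_⟩)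
    · rintro v ⟨w, e | e⟩
      · rcases e.2.2.2 with e | e
        · exact ⟨w, Or.inl e⟩
        · exact hiso v e.1
      · exact ⟨w, Or.inr (by simpa using e.2.2.2)⟩
    · exact hiso _ (Finset.mem_union_right _ (hy _ hi₀))
    · rintro ⟨w, e | e⟩
      · exact e.1 (Finset.mem_image_of_mem y hi₀)
      · exact e.1 (Finset.mem_image_of_mem y hi₀)
  have hZ : ((X ∪ Y) \ I.image y).card ≤ N := by
    rw [Finset.card_sdiff_of_subset (hyY.trans Finset.subset_union_right),
      Finset.card_union_of_disjoint hXY]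
    omega
  obtain ⟨c, hcL, hcadj⟩ := ih _ _ (h.completeOff hcl (I.image y)) hlt
    (card_le_of_isClique_completeOff hN hX hY hout (I.image y) hZ)
    (fun v => if v ∈ I.image x then M else L v) (fun v => by
      split_ifs
      · exact hM
      · exact hL v)
  have hcLv : ∀ v, v ∉ I.image x → c v ∈ L v := fun v hv => by simpa only [if_neg hv] using hcL v
  have hcM : ∀ v ∈ I.image x, c v ∈ M := fun v hv => by simpa only [if_pos hv] using hcL v
  classical
  let P := Finset.univ.filter fun o => o ∉ X ∪ Y ∧ ∀ v ∈ X, (R ⊔ B).Adj o v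
  let Q := Finset.univ.filter fun o => o ∉ X ∪ Y ∧ ∀ v ∈ Y, (R ⊔ B).Adj o v
  have hP := h.card_image_outside_le hcl hN Finset.subset_union_left hX hXne P
    (fun o ho => (Finset.mem_filter.1 ho).2) c
  have hQ := h.card_image_outside_le hcl hN Finset.subset_union_right hY hYne Q
    (fun o ho => (Finset.mem_filter.1 ho).2) c
  have hXD : ∀ v ∈ X, c v ∉ P.image c := fun v hv hmem => by
    obtain ⟨o, ho, e⟩ := Finset.mem_image.1 hmem
    obtain ⟨-, hoC, hoX⟩ := Finset.mem_filter.1 ho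
    exact hcadj o v (hadj o v (fun h => hoC (Finset.mem_union_right _ (hyY h))) (hnoty v hv)
      (hoX v hv).ne (Or.inl (hoX v hv))) e
  have hYE : ∀ v ∈ Y \ I.image y, c v ∉ Q.image c := fun v hv hmem => by
    rw [Finset.mem_sdiff] at hv
    obtain ⟨o, ho, e⟩ := Finset.mem_image.1 hmem
    obtain ⟨-, hoC, hoY⟩ := Finset.mem_filter.1 ho
    exact hcadj o v (hadj o v (fun h => hoC (Finset.mem_union_right _ (hyY h))) hv.2
      (hoY v hv.1).ne (Or.inl (hoY v hv.1))) e
  have hcinj : Set.InjOn c (((X ∪ Y) \ I.image y : Finset V) : Set V) := fun u hu v hv e => by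
    by_contra hne
    rw [Finset.mem_coe, Finset.mem_sdiff] at hu hv
    exact hcadj u v (hadj u v hu.2 hv.2 hne (Or.inr ⟨hu.1, hv.1⟩)) e
  have hT : ∀ T ⊆ (X \ I.image x) ∪ (Y \ I.image y), T.Nonempty → T.card + I.card ≤
      (T.biUnion (sideLists (X \ I.image x) L (P.image c) (Q.image c))).card := by
    by_contra! hdef
    obtain ⟨T, hT, -, hTlt, hTM⟩ := hph (P.image c) (Q.image c)
      (by rw [Finset.card_sdiff_of_subset hyY]; omega)
      (by rw [Finset.card_sdiff_of_subset hxX]; omega) hdef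
    have hTx : Disjoint T (I.image x) := Finset.disjoint_left.2 fun v hv hvx => by
      rcases Finset.mem_union.1 (hT hv) with hv | hv
      · exact (Finset.mem_sdiff.1 hv).2 hvx
      · exact hnotx v (Finset.mem_sdiff.1 hv).1 hvx
    have hsub : T ∪ I.image x ⊆ (X ∪ Y) \ I.image y := by
      refine Finset.union_subset (hT.trans (Finset.union_subset ?_ ?_)) ?_
      · exact fun v hv => Finset.mem_sdiff.2 ⟨Finset.mem_union_left _ (Finset.mem_sdiff.1 hv).1,
          hnoty v (Finset.mem_sdiff.1 hv).1⟩
      · exact Finset.sdiff_subset_sdiff Finset.subset_union_right subset_rfl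
      · exact fun v hv => Finset.mem_sdiff.2 ⟨Finset.mem_union_left _ (hxX hv), hnoty v (hxX hv)⟩
    have himg : (T ∪ I.image x).image c ⊆
        T.biUnion (sideLists (X \ I.image x) L (P.image c) (Q.image c)) := by
      refine Finset.image_subset_iff.2 fun v hv => ?_
      rcases Finset.mem_union.1 hv with hv | hv
      · refine Finset.mem_biUnion.2 ⟨v, hv, ?_⟩
        rcases Finset.mem_union.1 (hT hv) with hvA | hvB
        · rw [sideLists, if_pos hvA, Finset.mem_sdiff]
          rw [Finset.mem_sdiff] at hvA
          exact ⟨hcLv v hvA.2, hXD v hvA.1⟩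
        · have hvY := (Finset.mem_sdiff.1 hvB).1
          rw [sideLists, if_neg fun h =>
            Finset.disjoint_left.1 hXY (Finset.mem_sdiff.1 h).1 hvY, Finset.mem_sdiff]
          exact ⟨hcLv v (hnotx v hvY), hYE v hvB⟩
      · exact hTM (Finset.mem_sdiff.2 ⟨hcM v hv, hXD v (hxX hv)⟩)
    have hle := Finset.card_le_card himg
    rw [Finset.card_image_of_injOn (hcinj.mono (by exact_mod_cast hsub)),
      Finset.card_union_of_disjoint hTx] at hle
    omega
  have : Nonempty V := ⟨i₀⟩
  obtain ⟨d, hdX, hdY, hd⟩ := exists_coloring_of_pairs (R ⊔ B) hXY I x y hx hy hxinj hyinj hxy L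
    (P.image c) (Q.image c)
    (fun v _ => by
      have h1 := hL v
      have h2 := Finset.le_card_sdiff (P.image c) (L v)
      omega)
    (fun v _ => by
      have h1 := hL v
      have h2 := Finset.le_card_sdiff (Q.image c) (L v)
      omega) hT
  have hmix : ∀ o ∉ X ∪ Y, ∀ v ∈ X ∪ Y, (R ⊔ B).Adj o v → c o ≠ d v := by
    intro o ho v hv hov e
    rcases hout o ho with h1 | h1 | h1
    · exact h1 v hv hov
    · refine (Finset.mem_sdiff.1 (hdX v ((h1 v hv).1 hov))).2 (e ▸ Finset.mem_image_of_mem c ?_)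
      exact Finset.mem_filter.2 ⟨Finset.mem_univ _, ho, fun w hw =>
        (h1 w (Finset.mem_union_left _ hw)).2 hw⟩
    · refine (Finset.mem_sdiff.1 (hdY v ((h1 v hv).1 hov))).2 (e ▸ Finset.mem_image_of_mem c ?_)
      exact Finset.mem_filter.2 ⟨Finset.mem_univ _, ho, fun w hw =>
        (h1 w (Finset.mem_union_right _ hw)).2 hw⟩
  refine ⟨fun v => if v ∈ X ∪ Y then d v else c v, fun v => ?_, fun a b hab => ?_⟩
  · dsimp only
    split_ifs with hv
    · rcases Finset.mem_union.1 hv with hv | hv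
      · exact (Finset.mem_sdiff.1 (hdX v hv)).1
      · exact (Finset.mem_sdiff.1 (hdY v hv)).1
    · exact hcLv v fun h => hv (Finset.mem_union_left _ (hxX h))
  · dsimp only
    split_ifs with ha hb hb
    · exact hd a ha b hb hab
    · exact (hmix b hb a ha hab.symm).symm
    · exact hmix a ha b hb hab
    · have hnot : ∀ v ∉ X ∪ Y, v ∉ I.image y := fun v hv h =>
        hv (Finset.mem_union_right _ (hyY h))
      exact hcadj a b (hadj a b (hnot a ha) (hnot b hb) hab.ne (Or.inl hab))

end Step

/-- Two disjoint cliques with `m` vertices too many to form a clique contain `m` disjoint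
non-edges between them. -/
theorem exists_disjoint_nonedges {V : Type*} [DecidableEq V] (G : SimpleGraph V) {N m : ℕ}
    (hN : ∀ s : Finset V, G.IsClique (s : Set V) → s.card ≤ N) {X Y : Finset V}
    (hXY : Disjoint X Y) (hX : G.IsClique (X : Set V)) (hY : G.IsClique (Y : Set V))
    (hcard : X.card + Y.card = N + m) :
    ∃ I ⊆ X, I.card = m ∧ ∃ y : V → V, Set.InjOn y I ∧ ∀ i ∈ I, y i ∈ Y ∧ ¬ G.Adj i (y i) := by
  classical
  have hYN := hN Y hY
  obtain ⟨f, hfinj, hf⟩ := Finset.exists_injOn_of_card_le_biUnion X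
    (fun x => (Y.filter fun v => ¬ G.Adj x v).disjSum (Finset.range (N - Y.card))) (by
      intro W hW
      obtain rfl | ⟨w, hw⟩ := W.eq_empty_or_nonempty
      · simp
      let Z := Y.filter fun v => ∃ x ∈ W, ¬ G.Adj x v
      have hsub : Z.disjSum (Finset.range (N - Y.card)) ⊆ W.biUnion fun x =>
          (Y.filter fun v => ¬ G.Adj x v).disjSum (Finset.range (N - Y.card)) := by
        rintro (v | k) hv
        · obtain ⟨hvY, x, hx, hxv⟩ := Finset.mem_filter.1 (Finset.inl_mem_disjSum.1 hv)
          exact Finset.mem_biUnion.2 ⟨x, hx, Finset.inl_mem_disjSum.2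
            (Finset.mem_filter.2 ⟨hvY, hxv⟩)⟩
        · exact Finset.mem_biUnion.2 ⟨w, hw, Finset.inr_mem_disjSum.2 (Finset.inr_mem_disjSum.1 hv)⟩
      have hle := Finset.card_le_card hsub
      rw [Finset.card_disjSum, Finset.card_range] at hle
      have hWZ : ∀ u ∈ W, ∀ v ∈ Y \ Z, G.Adj u v := fun u hu v hv => by
        by_contra huv
        rw [Finset.mem_sdiff] at hv
        exact hv.2 (Finset.mem_filter.2 ⟨hv.1, u, hu, huv⟩)
      have hcl := hN (W ∪ (Y \ Z)) (by
        rw [Finset.coe_union]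
        rintro u (hu | hu) v (hv | hv) huv
        · exact hX (hW hu) (hW hv) huv
        · exact hWZ u hu v hv
        · exact (hWZ v hv u hu).symm
        · exact hY (Finset.sdiff_subset hu) (Finset.sdiff_subset hv) huv)
      have hZY : Z ⊆ Y := Finset.filter_subset _ _
      have hZc := Finset.card_le_card hZY
      rw [Finset.card_union_of_disjoint (Finset.disjoint_of_subset_left hW
        (Finset.disjoint_of_subset_right Finset.sdiff_subset hXY)),
        Finset.card_sdiff_of_subset hZY] at hcl
      omega)
  have hright : (X.filter fun x => ¬ (f x).isLeft).card ≤ N - Y.card := by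
    have hsub : (X.filter fun x => ¬ (f x).isLeft).image f ⊆
        (Finset.range (N - Y.card)).image Sum.inr := by
      refine Finset.image_subset_iff.2 fun x hx => ?_
      rw [Finset.mem_filter] at hx
      have h1 := hf x hx.1
      have h2 := hx.2
      cases hfx : f x with
      | inl v => simp [hfx] at h2
      | inr k =>
        rw [hfx, Finset.inr_mem_disjSum] at h1
        exact Finset.mem_image_of_mem _ h1
    have h1 := Finset.card_le_card hsub
    rw [Finset.card_image_of_injOn (hfinj.mono (by exact_mod_cast Finset.filter_subset _ _))] at h1
    exact h1.trans (Finset.card_image_le.trans (Finset.card_range _).le)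
  have hsplit := X.card_filter_add_card_filter_not (fun x => ((f x).isLeft : Prop))
  obtain ⟨I, hI, hIm⟩ := Finset.exists_subset_card_eq
    (s := X.filter fun x => (f x).isLeft) (n := m) (by omega)
  have hget : ∀ i ∈ I, f i = Sum.inl (Sum.elim id (fun _ => i) (f i)) := fun i hi => by
    have h2 := (Finset.mem_filter.1 (hI hi)).2
    cases hfi : f i with
    | inl v => rfl
    | inr k => simp [hfi] at h2
  refine ⟨I, hI.trans (Finset.filter_subset _ _), hIm, fun i => Sum.elim id (fun _ => i) (f i),
    fun i hi j hj e => ?_, fun i hi => ?_⟩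
  · refine hfinj (Finset.filter_subset _ _ (hI hi)) (Finset.filter_subset _ _ (hI hj)) ?_
    rw [hget i hi, hget j hj]
    exact congrArg Sum.inl e
  · have h1 := hf i (Finset.filter_subset _ _ (hI hi))
    rw [hget i hi, Finset.inl_mem_disjSum, Finset.mem_filter] at h1
    exact h1

section Main

variable {V : Type*} [Fintype V] {R B : SimpleGraph V}

theorem IsPathPair.exists_coloring_of_large_component (h : IsPathPair R B) {N : ℕ}
    (hN : ∀ s : Finset V, (R ⊔ B).IsClique (s : Set V) → s.card ≤ N)
    (L : V → Finset ℕ) (hL : ∀ v, N ≤ (L v).card) (v₀ : V)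
    (hv₀ : N < {w | R.Reachable v₀ w}.ncard)
    (ih : ∀ R' B' : SimpleGraph V, IsPathPair R' B' →
      (R' ⊔ B').nonisolatedCard < (R ⊔ B).nonisolatedCard →
      (∀ s : Finset V, (R' ⊔ B').IsClique (s : Set V) → s.card ≤ N) →
      ∀ L' : V → Finset ℕ, (∀ v, N ≤ (L' v).card) →
      ∃ c : V → ℕ, (∀ v, c v ∈ L' v) ∧ ∀ a b, (R' ⊔ B').Adj a b → c a ≠ c b) :
    ∃ c : V → ℕ, (∀ v, c v ∈ L v) ∧ ∀ a b, (R ⊔ B).Adj a b → c a ≠ c b := by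
  classical
  set C : Set V := {w | R.Reachable v₀ w} with hC
  have hconn : ∀ u ∈ C, ∀ v ∈ C, R.Reachable u v := fun u hu v hv => hu.symm.trans hv
  have hcl : ∀ u ∈ C, ∀ v, R.Adj u v → v ∈ C := fun u hu v huv => hu.trans huv.reachable
  have hnot : ¬ (R ⊔ B).IsClique C := fun hc => by
    have h1 := hN C.toFinset (by rwa [Set.coe_toFinset])
    rw [Set.ncard_eq_toFinset_card'] at hv₀
    omega
  obtain ⟨X', hX'C, hX', hY', hout⟩ := h.exists_component_partition hconn hcl hnot
  obtain ⟨X, rfl⟩ : ∃ X : Finset V, (X : Set V) = X' := ⟨X'.toFinset, Set.coe_toFinset _⟩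
  obtain ⟨Y, hYC⟩ : ∃ Y : Finset V, (Y : Set V) = C \ X := ⟨(C \ X).toFinset, Set.coe_toFinset _⟩
  rw [← hYC] at hY'
  have hXY : Disjoint X Y := by
    rw [← Finset.disjoint_coe, hYC]
    exact Set.disjoint_sdiff_right
  have hmem : ∀ v, v ∈ X ∪ Y ↔ v ∈ C := fun v => by
    have h1 : v ∈ Y ↔ v ∈ C ∧ v ∉ X := by
      rw [← Finset.mem_coe, hYC]
      rfl
    rw [Finset.mem_union, h1]
    by_cases hv : v ∈ X
    · simpa [hv] using hX'C hv
    · simp [hv]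
  have hcardC : X.card + Y.card = C.ncard := by
    rw [← Finset.card_union_of_disjoint hXY, ← Set.ncard_coe_finset]
    congr 1
    ext v
    exact hmem v
  have hcl' : ∀ u ∈ X ∪ Y, ∀ v, R.Adj u v → v ∈ X ∪ Y := fun u hu v huv =>
    (hmem v).2 (hcl u ((hmem u).1 hu) v huv)
  have hout' : ∀ o ∉ X ∪ Y, (∀ v ∈ X ∪ Y, ¬ (R ⊔ B).Adj o v) ∨
      (∀ v ∈ X ∪ Y, (R ⊔ B).Adj o v ↔ v ∈ X) ∨ (∀ v ∈ X ∪ Y, (R ⊔ B).Adj o v ↔ v ∈ Y) := by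
    intro o ho
    have key : ∀ S : Set V, {v ∈ C | (R ⊔ B).Adj o v} = S →
        ∀ v ∈ X ∪ Y, (R ⊔ B).Adj o v ↔ v ∈ S := fun S hS v hv =>
      hS ▸ ⟨fun e => ⟨(hmem v).1 hv, e⟩, fun e => e.2⟩
    rcases hout o fun h => ho ((hmem o).2 h) with h1 | h1 | h1
    · exact Or.inl fun v hv e => (key _ h1 v hv).1 e
    · exact Or.inr (Or.inl (key _ h1))
    · exact Or.inr (Or.inr (key _ (h1.trans hYC.symm)))
  obtain ⟨m, hm⟩ : ∃ m, X.card + Y.card = N + m := ⟨X.card + Y.card - N, by omega⟩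
  obtain ⟨I, hIX, hIm, y, hyinj, hy⟩ := exists_disjoint_nonedges (R ⊔ B) hN hXY hX' hY' hm
  have hI : I.Nonempty := Finset.card_pos.1 (by omega)
  have hyY : I.image y ⊆ Y := Finset.image_subset_iff.2 fun i hi => (hy i hi).1
  have hiso : ∀ u ∈ X ∪ Y, ∃ v, (R ⊔ B).Adj u v := fun u hu => by
    have hNpos := hN {u} (by simp)
    rw [Finset.card_singleton] at hNpos
    obtain ⟨w, hw, hwu⟩ := Set.exists_ne_of_one_lt_ncard (s := C) (by omega) u
    obtain ⟨p⟩ := hconn u ((hmem u).1 hu) w hw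
    cases p with
    | nil => exact (hwu rfl).elim
    | cons e _ => exact ⟨_, Or.inl e⟩
  have hcx : (I.image id).card = I.card := by rw [Finset.image_id]
  have hcy : (I.image y).card = I.card := Finset.card_image_of_injOn hyinj
  have hdisj : Disjoint (X \ I.image id) (Y \ I.image y) :=
    Finset.disjoint_of_subset_left Finset.sdiff_subset
      (Finset.disjoint_of_subset_right Finset.sdiff_subset hXY)
  have hIXc := Finset.card_le_card hIX
  have hIYc := Finset.card_le_card hyY
  have hsize : (X \ I.image id).card + (Y \ I.image y).card + I.card = N := by
    rw [Finset.card_sdiff_of_subset (by rwa [Finset.image_id]), Finset.card_sdiff_of_subset hyY]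
    omega
  obtain ⟨M, hM, hph | hph⟩ := exists_phantom_list (X \ I.image id) (Y \ I.image y) hdisj L I.card
    (fun v _ => hsize ▸ hL v)
  · exact h.exists_coloring_step hN L hL hXY hX' hY' hcl' hout' hiso I hI id y
      (fun i hi => hIX hi) (fun i hi => (hy i hi).1) (Set.injOn_id _) hyinj
      (fun i hi => (hy i hi).2) (by omega) M (hsize ▸ hM) hph ih
  · rw [Finset.union_comm] at hcl' hout' hiso
    refine h.exists_coloring_step hN L hL hXY.symm hY' hX' hcl'
      (fun o ho => (hout' o ho).imp_right Or.symm) hiso I hI y id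
      (fun i hi => (hy i hi).1) (fun i hi => hIX hi) hyinj (Set.injOn_id _)
      (fun i hi e => (hy i hi).2 e.symm) (by omega) M (hsize ▸ hM) (fun D E hD hE => ?_) ih
    rw [Finset.union_comm]
    rintro ⟨T, hT, hne, hlt⟩
    rw [biUnion_sideLists_comm hdisj L E D hT] at hlt
    obtain ⟨T', hT', hne', hlt', hMT⟩ := hph E D hE hD ⟨T, hT, hne, hlt⟩
    refine ⟨T', hT', hne', ?_⟩
    rw [biUnion_sideLists_comm hdisj L E D hT']
    exact ⟨hlt', hMT⟩

/-- If all components of both graphs are small, Galvin's theorem applies. -/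
theorem exists_coloring_of_small_components {N : ℕ}
    (hR : ∀ v, {w | R.Reachable v w}.ncard ≤ N) (hB : ∀ v, {w | B.Reachable v w}.ncard ≤ N)
    (L : V → Finset ℕ) (hL : ∀ v, N ≤ (L v).card) :
    ∃ c : V → ℕ, (∀ v, c v ∈ L v) ∧ ∀ a b, (R ⊔ B).Adj a b → c a ≠ c b := by
  classical
  have hcomp : ∀ H : SimpleGraph V, (∀ v, {w | H.Reachable v w}.ncard ≤ N) →
      ∀ u : H.ConnectedComponent,
        (Finset.univ.filter fun v => H.connectedComponentMk v = u).card ≤ N := by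
    intro H hH u
    induction u using ConnectedComponent.ind with
    | h v =>
      refine le_of_eq_of_le ?_ (hH v)
      rw [← Set.ncard_coe_finset]
      congr 1
      ext w
      simp [ConnectedComponent.eq, reachable_comm]
  obtain ⟨φ, hφ, hφR, hφB⟩ := exists_edgeColoring R.connectedComponentMk B.connectedComponentMk N
    (hcomp R hR) (hcomp B hB)
  obtain ⟨c, hcL, hc⟩ := exists_listColoring_of_outdegree_lt R.connectedComponentMk
    B.connectedComponentMk φ hφR hφB Finset.univ L (fun v _ => by
      refine lt_of_lt_of_le ?_ (hL v)
      have h1 : ((Finset.univ.filter fun w =>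
          (R.connectedComponentMk w = R.connectedComponentMk v ∧ φ w < φ v) ∨
          (B.connectedComponentMk w = B.connectedComponentMk v ∧ φ v < φ w)).image φ) ⊆
          (Finset.range N).erase (φ v) := by
        refine Finset.image_subset_iff.2 fun w hw => ?_
        rw [Finset.mem_erase, Finset.mem_range]
        rcases (Finset.mem_filter.1 hw).2 with e | e
        · exact ⟨e.2.ne, hφ w⟩
        · exact ⟨e.2.ne', hφ w⟩
      have h2 := Finset.card_le_card h1
      rw [Finset.card_image_of_injOn, Finset.card_erase_of_mem (Finset.mem_range.2 (hφ v)),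
        Finset.card_range] at h2
      · have := hφ v
        omega
      · intro w hw w' hw' e
        rcases (Finset.mem_filter.1 hw).2 with e1 | e1 <;>
          rcases (Finset.mem_filter.1 hw').2 with e2 | e2
        · exact hφR w w' (e1.1.trans e2.1.symm) e
        · omega
        · omega
        · exact hφB w w' (e1.1.trans e2.1.symm) e)
  exact ⟨c, fun v => hcL v (Finset.mem_univ v), fun a b hab =>
    hc a (Finset.mem_univ a) b (Finset.mem_univ b) hab.ne (hab.imp
      (fun e => ConnectedComponent.eq.2 e.reachable) fun e => ConnectedComponent.eq.2 e.reachable)⟩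

theorem IsPathPair.exists_coloring (h : IsPathPair R B) {N : ℕ}
    (hN : ∀ s : Finset V, (R ⊔ B).IsClique (s : Set V) → s.card ≤ N)
    (L : V → Finset ℕ) (hL : ∀ v, N ≤ (L v).card) :
    ∃ c : V → ℕ, (∀ v, c v ∈ L v) ∧ ∀ a b, (R ⊔ B).Adj a b → c a ≠ c b := by
  induction hk : (R ⊔ B).nonisolatedCard using Nat.strong_induction_on generalizing R B L with
  | _ k ih =>
    have ih' : ∀ R' B' : SimpleGraph V, IsPathPair R' B' →
        (R' ⊔ B').nonisolatedCard < (R ⊔ B).nonisolatedCard →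
        (∀ s : Finset V, (R' ⊔ B').IsClique (s : Set V) → s.card ≤ N) →
        ∀ L' : V → Finset ℕ, (∀ v, N ≤ (L' v).card) →
        ∃ c : V → ℕ, (∀ v, c v ∈ L' v) ∧ ∀ a b, (R' ⊔ B').Adj a b → c a ≠ c b :=
      fun R' B' h' hlt hN' L' hL' => ih _ (hk ▸ hlt) h' hN' L' hL' rfl
    by_cases hR : ∃ v, N < {w | R.Reachable v w}.ncard
    · obtain ⟨v, hv⟩ := hR
      exact h.exists_coloring_of_large_component hN L hL v hv ih'
    by_cases hB : ∃ v, N < {w | B.Reachable v w}.ncard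
    · obtain ⟨v, hv⟩ := hB
      rw [sup_comm] at hN ih' ⊢
      exact h.symm.exists_coloring_of_large_component hN L hL v hv ih'
    push Not at hR hB
    exact exists_coloring_of_small_components hR hB L hL

end Main

end SimpleGraph

theorem elementary_omega_choosable
    {V : Type*} [Fintype V] (G : SimpleGraph V) (hG : G.IsElementary)
    (L : V → Finset ℕ) (hL : ∀ v, G.cliqueNum ≤ (L v).card) :
    ∃ c : V → ℕ, (∀ v, c v ∈ L v) ∧ ∀ a b, G.Adj a b → c a ≠ c b := by
  obtain ⟨col, hcol⟩ := hG
  let H : Bool → SimpleGraph V := fun t =>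
    { Adj := fun a b => G.Adj a b ∧ col s(a, b) = t
      symm := ⟨fun a b e => ⟨e.1.symm, Sym2.eq_swap (a := a) ▸ e.2⟩⟩
      loopless := ⟨fun _ e => e.1.ne rfl⟩ }
  have hsup : H true ⊔ H false = G := by
    ext a b
    refine ⟨fun e => e.elim And.left And.left, fun e => ?_⟩
    cases ht : col s(a, b)
    · exact Or.inr ⟨e, ht⟩
    · exact Or.inl ⟨e, ht⟩
  have hpath : ∀ t a b c, (H t).Adj a b → (H t).Adj b c → a ≠ c → G.Adj a c :=
    fun t a b c hab hbc hne => by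
      by_contra hac
      exact hcol a b c hab.1 hbc.1 hac hne (hab.2.trans hbc.2.symm)
  have hpair : SimpleGraph.IsPathPair (H true) (H false) :=
    ⟨hsup.symm ▸ hpath true, hsup.symm ▸ hpath false⟩
  have key := hpair.exists_coloring (N := G.cliqueNum)
    (hsup.symm ▸ fun s hs => hs.card_le_cliqueNum) L hL
  rwa [hsup] at key
end

section
/- Let $H$ be a finite cobipartite graph whose vertex set is partitioned into two cliques $X$ and $Y$ with $|X| \ge |Y|$, such that $H$ has exactly $|Y|$ non-edges between $X$ and $Y$ and these non-edges form a matching in the complement $\overline{H}$. Let $L$ be a list assignment of $H$ such that $|L(x)| \ge |X|$ for all $x \in X$ and $|L(y)| \ge |Y|$ for all $y \in Y$. Then $H$ admits a proper $L$-coloring. -/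
/-- Hall's theorem for the lists of a finite set of elements. -/
theorem Finset.exists_injOn_mem_of_card_le_biUnion {V α : Type*} [DecidableEq V] [DecidableEq α]
    [Nonempty α] (T : Finset V) (L : V → Finset α)
    (h : ∀ S ⊆ T, S.card ≤ (S.biUnion L).card) :
    ∃ c : V → α, Set.InjOn c T ∧ ∀ v ∈ T, c v ∈ L v := by
  obtain ⟨g, hg, hgL⟩ := (Finset.all_card_le_biUnion_card_iff_exists_injective
    (fun v : {v // v ∈ T} => L v.1)).1 (by
      intro s
      have hs := h (s.map (Function.Embedding.subtype _)) (by
        intro v hv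
        obtain ⟨w, -, rfl⟩ := Finset.mem_map.1 hv
        exact w.2)
      rw [Finset.card_map, Finset.map_eq_image, Finset.image_biUnion] at hs
      exact hs)
  refine ⟨fun v => if hv : v ∈ T then g ⟨v, hv⟩ else Classical.arbitrary α, ?_, ?_⟩
  · intro a ha b hb hab
    have ha' : a ∈ T := ha
    have hb' : b ∈ T := hb
    simp only [ha', hb', dif_pos] at hab
    simpa using hg hab
  · intro v hv
    simpa only [hv, dif_pos] using hgL ⟨v, hv⟩

/-- If the lists of matched elements are disjoint, Hall's condition holds on `X ∪ Y`. -/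
theorem Finset.card_le_card_biUnion_of_disjoint_matched {V α : Type*} [DecidableEq V]
    [DecidableEq α] {f : V → V} {X Y : Finset V} {L : V → Finset α}
    (hfX : ∀ y ∈ Y, f y ∈ X) (hf : Set.InjOn f Y)
    (hLX : ∀ x ∈ X, X.card ≤ (L x).card) (hLY : ∀ y ∈ Y, Y.card ≤ (L y).card)
    (hL : ∀ y ∈ Y, Disjoint (L y) (L (f y))) {S : Finset V} (hS : S ⊆ X ∪ Y) :
    S.card ≤ (S.biUnion L).card := by
  by_cases hpair : ∃ y ∈ Y, y ∈ S ∧ f y ∈ S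
  · obtain ⟨y, hy, hyS, hfyS⟩ := hpair
    calc S.card ≤ X.card + Y.card := (card_le_card hS).trans (card_union_le X Y)
      _ ≤ (L (f y)).card + (L y).card := add_le_add (hLX _ (hfX y hy)) (hLY y hy)
      _ = (L y ∪ L (f y)).card := by rw [card_union_of_disjoint (hL y hy), add_comm]
      _ ≤ (S.biUnion L).card := card_le_card <|
        union_subset (subset_biUnion_of_mem L hyS) (subset_biUnion_of_mem L hfyS)
  push Not at hpair
  by_cases hx : ∃ x ∈ S, x ∈ X
  · obtain ⟨x, hxS, hxX⟩ := hx
    refine le_trans ?_ ((hLX x hxX).trans (card_le_card (subset_biUnion_of_mem L hxS)))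
    refine card_le_card_of_injOn (fun v => if v ∈ X then v else f v) ?_ ?_
    · intro v hv
      have := hS hv
      grind
    · intro a ha b hb hab
      have haS : a ∈ S := ha
      have hbS : b ∈ S := hb
      have ha' := hS haS
      have hb' := hS hbS
      have hinj : ∀ u ∈ Y, ∀ v ∈ Y, f u = f v → u = v := fun u hu v hv => hf hu hv
      grind
  · push Not at hx
    have hSY : S ⊆ Y := fun v hv => (mem_union.1 (hS hv)).resolve_left (hx v hv)
    obtain rfl | ⟨y, hy⟩ := S.eq_empty_or_nonempty
    · simp
    · exact (card_le_card hSY).trans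
        ((hLY y (hSY hy)).trans (card_le_card (subset_biUnion_of_mem L hy)))

/-- Elements of `X ∪ Y` can be coloured from their lists so that only elements matched by `f`
share a colour. -/
theorem Finset.exists_list_coloring_of_matching {V α : Type*} [DecidableEq V] [DecidableEq α]
    [Nonempty α] (f : V → V) (X Y : Finset V) (L : V → Finset α) (hdisj : Disjoint X Y)
    (hfX : ∀ y ∈ Y, f y ∈ X) (hf : Set.InjOn f Y)
    (hLX : ∀ x ∈ X, X.card ≤ (L x).card) (hLY : ∀ y ∈ Y, Y.card ≤ (L y).card) :
    ∃ c : V → α, (∀ v ∈ X ∪ Y, c v ∈ L v) ∧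
      ∀ a ∈ X ∪ Y, ∀ b ∈ X ∪ Y, c a = c b → a = b ∨ (a ∈ Y ∧ b = f a) ∨ (b ∈ Y ∧ a = f b) := by
  induction hn : Y.card generalizing X Y L with
  | zero =>
    obtain ⟨c, hc, hcL⟩ := exists_injOn_mem_of_card_le_biUnion (X ∪ Y) L fun S hS =>
      card_le_card_biUnion_of_disjoint_matched hfX hf hLX hLY
        (fun y hy => by simp [card_eq_zero.1 hn] at hy) hS
    exact ⟨c, hcL, fun a ha b hb hab => Or.inl (hc ha hb hab)⟩
  | succ n ih =>
    by_cases hL : ∀ y ∈ Y, Disjoint (L y) (L (f y))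
    · obtain ⟨c, hc, hcL⟩ := exists_injOn_mem_of_card_le_biUnion (X ∪ Y) L fun S hS =>
        card_le_card_biUnion_of_disjoint_matched hfX hf hLX hLY hL hS
      exact ⟨c, hcL, fun a ha b hb hab => Or.inl (hc ha hb hab)⟩
    · push Not at hL
      obtain ⟨y, hy, hyL⟩ := hL
      obtain ⟨k, hky, hkf⟩ := not_disjoint_iff.1 hyL
      have hinj : ∀ u ∈ Y, ∀ v ∈ Y, f u = f v → u = v := fun u hu v hv => hf hu hv
      obtain ⟨c, hcL, hc⟩ := ih (X.erase (f y)) (Y.erase y) (fun v => (L v).erase k)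
        (hdisj.mono (erase_subset _ _) (erase_subset _ _))
        (by grind) (hf.mono (by simp))
        (fun x hx => by
          have := hLX x (mem_of_mem_erase hx)
          have := pred_card_le_card_erase (s := L x) (a := k)
          have := card_erase_of_mem (hfX y hy)
          omega)
        (fun x hx => by
          have := hLY x (mem_of_mem_erase hx)
          have := pred_card_le_card_erase (s := L x) (a := k)
          have := card_erase_of_mem hy
          omega)
        (by rw [card_erase_of_mem hy]; omega)
      have hrest : ∀ v ∈ X ∪ Y, v ≠ y → v ≠ f y → v ∈ X.erase (f y) ∪ Y.erase y := by grind
      have hck : ∀ v ∈ X ∪ Y, v ≠ y → v ≠ f y → c v ∈ L v ∧ c v ≠ k := fun v hv h₁ h₂ =>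
        (mem_erase.1 (hcL v (hrest v hv h₁ h₂))).symm
      refine ⟨fun v => if v = y ∨ v = f y then k else c v, ?_, ?_⟩
      · intro v hv
        have := hck v hv
        grind
      · intro a ha b hb hab
        have := hck a ha
        have := hck b hb
        by_cases ha' : a = y ∨ a = f y <;> by_cases hb' : b = y ∨ b = f y
        · grind
        · grind
        · grind
        · simp only [ha', hb', if_false] at hab
          push Not at ha' hb'
          have := hc a (hrest a ha ha'.1 ha'.2) b (hrest b hb hb'.1 hb'.2) hab
          grind


theorem cobipartite_matching_nonedges_list_colorable
    {V : Type*} [Fintype V] [DecidableEq V] (H : SimpleGraph V)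
    [DecidableRel H.Adj]
    (X Y : Finset V) (hdisj : Disjoint X Y) (hcover : ∀ v : V, v ∈ X ∨ v ∈ Y)
    (hX : H.IsClique (X : Set V)) (hY : H.IsClique (Y : Set V))
    (hXY : Y.card ≤ X.card)
    -- the non-edges of `H` between `X` and `Y`
    (N : Finset (V × V)) (hN : N = (X ×ˢ Y).filter fun p => ¬ H.Adj p.1 p.2)
    -- there are exactly `|Y|` such non-edges
    (hNcard : N.card = Y.card)
    -- and they form a matching in the complement of `H`
    (hmatch : ∀ p ∈ N, ∀ q ∈ N, p ≠ q → p.1 ≠ q.1 ∧ p.2 ≠ q.2)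
    (L : V → Finset ℕ)
    (hLX : ∀ x ∈ X, X.card ≤ (L x).card) (hLY : ∀ y ∈ Y, Y.card ≤ (L y).card) :
    ∃ c : V → ℕ, (∀ v, c v ∈ L v) ∧ ∀ a b, H.Adj a b → c a ≠ c b := by
  have hsurj : N.image Prod.snd = Y := by
    refine Finset.eq_of_subset_of_card_le ?_ ?_
    · intro y hy
      obtain ⟨p, hp, rfl⟩ := Finset.mem_image.1 hy
      rw [hN] at hp
      exact (Finset.mem_product.1 (Finset.mem_filter.1 hp).1).2
    · rw [Finset.card_image_of_injOn, hNcard]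
      intro p hp q hq hpq
      by_contra hne
      exact (hmatch p hp q hq hne).2 hpq
  have hex : ∀ y, ∃ x, y ∈ Y → (x, y) ∈ N := by
    intro y
    by_cases hy : y ∈ Y
    · rw [← hsurj] at hy
      obtain ⟨p, hp, rfl⟩ := Finset.mem_image.1 hy
      exact ⟨p.1, fun _ => hp⟩
    · exact ⟨y, fun h => absurd h hy⟩
  choose f hfN using hex
  have hf : ∀ y ∈ Y, f y ∈ X ∧ ¬ H.Adj (f y) y := by
    intro y hy
    have := hfN y hy
    simp only [hN, Finset.mem_filter, Finset.mem_product] at this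
    exact ⟨this.1.1, this.2⟩
  obtain ⟨c, hcL, hc⟩ := Finset.exists_list_coloring_of_matching f X Y L hdisj
    (fun y hy => (hf y hy).1)
    (fun y hy z hz hyz => by
      by_contra hne
      exact (hmatch _ (hfN y hy) _ (hfN z hz) (fun h => hne (congrArg Prod.snd h))).1 hyz)
    hLX hLY
  have hmem : ∀ v, v ∈ X ∪ Y := fun v => Finset.mem_union.2 (hcover v)
  refine ⟨c, fun v => hcL v (hmem v), fun a b hab hcab => ?_⟩
  obtain rfl | ⟨ha, rfl⟩ | ⟨hb, rfl⟩ := hc a (hmem a) b (hmem b) hcab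
  · exact H.irrefl hab
  · exact (hf a ha).2 hab.symm
  · exact (hf b hb).2 hab
end
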